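/- arXiv:1708.05378 — 4 statements merged into one kernel-verified Lean document; each statement's English description precedes it below -/
import Mathlib

section
/- Let k be an algebraically closed field of characteristic zero, let N₁,…,N_g ∈ M_d(k) be jointly nilpotent with every length-m product vanishing, and let b₁,…,b_g, c ∈ k^d. Define Λ = Σ_{j=1}^g N_j x_j ∈ M_d(k⟨x⟩), b = Σ_{j=1}^g b_j x_j ∈ (k⟨x⟩)^d, and the noncommutative polynomial f = 1 − Σ_{i=0}^{m−1} cᵀ·Λ^i·b ∈ k⟨x₁,…,x_g⟩ (so that f = 1 − cᵀ(I_d − Λ)⁻¹b). Then for every n ∈ ℕ and every X ∈ M_n(k)^g one has det f(X) = det( I_{dn} − Σ_{j=1}^g (N_j + b_j·cᵀ) ⊗ X_j ). -/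
open Matrix MvPolynomial

noncomputable section

/-- Evaluation of the monic linear pencil `L = I_d - ∑ j, A j * x j` at a `g`-tuple `X` of
`n × n` matrices over a commutative `k`-algebra `R`, via the Kronecker product. -/
def pencilEval {k : Type*} [CommRing k] {g d n : ℕ} {R : Type*} [CommRing R] [Algebra k R]
    (A : Fin g → Matrix (Fin d) (Fin d) k) (X : Fin g → Matrix (Fin n) (Fin n) R) :
    Matrix (Fin d × Fin n) (Fin d × Fin n) R :=
  1 - ∑ j, Matrix.kroneckerMap (· * ·) ((A j).map fun a => algebraMap k R a) (X j)

/-- Evaluation of a noncommutative polynomial at a `g`-tuple of matrices. -/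
def scalarEval {k : Type*} [CommRing k] {g n : ℕ} {R : Type*} [CommRing R] [Algebra k R]
    (f : FreeAlgebra k (Fin g)) (X : Fin g → Matrix (Fin n) (Fin n) R) :
    Matrix (Fin n) (Fin n) R :=
  FreeAlgebra.lift k X f

/-- The linear part `Λ = ∑ j, N j * x j` as a matrix over the free algebra. -/
def linPart {k : Type*} [CommRing k] {g d : ℕ} (N : Fin g → Matrix (Fin d) (Fin d) k) :
    Matrix (Fin d) (Fin d) (FreeAlgebra k (Fin g)) :=
  ∑ j, (N j).map fun a => a • FreeAlgebra.ι k j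

/-- The noncommutative polynomial `f = 1 - ∑_{i<m} cᵀ Λ^i b`, i.e. `1 - cᵀ (I - Λ)⁻¹ b` for
jointly nilpotent coefficients with nilpotency order `m`. -/
def fmPoly {k : Type*} [CommRing k] {g d : ℕ} (m : ℕ)
    (N : Fin g → Matrix (Fin d) (Fin d) k) (b : Fin g → Fin d → k) (c : Fin d → k) :
    FreeAlgebra k (Fin g) :=
  1 - ∑ i ∈ Finset.range m, ∑ ι, ∑ κ,
    c ι • ((linPart N ^ i) ι κ * ∑ j, b j κ • FreeAlgebra.ι k j)

/-- The `r`-th power of a finite sum in a possibly noncommutative semiring, expanded over words. -/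
theorem sum_pow_eq_sum_prod_ofFn {ι R : Type*} [Fintype ι] [Semiring R] (A : ι → R) (r : ℕ) :
    (∑ j, A j) ^ r = ∑ w : Fin r → ι, (List.ofFn fun i => A (w i)).prod := by
  induction r with
  | zero => simp
  | succ r ih =>
    rw [pow_succ', ih, Finset.sum_mul_sum, ← (Fin.consEquiv fun _ => ι).sum_comp,
      Fintype.sum_prod_type]
    simp [Fin.consEquiv, List.ofFn_succ]

theorem prod_map_kronecker {ι R m n : Type*} [CommSemiring R] [Fintype m] [DecidableEq m]
    [Fintype n] [DecidableEq n] (A : ι → Matrix m m R) (B : ι → Matrix n n R) (l : List ι) :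
    (l.map fun j => kroneckerMap (· * ·) (A j) (B j)).prod =
      kroneckerMap (· * ·) (l.map A).prod (l.map B).prod := by
  induction l with
  | nil => exact (Matrix.one_kronecker_one).symm
  | cons a l ih =>
    simp only [List.map_cons, List.prod_cons, ih]
    exact (Matrix.mul_kronecker_mul _ _ _ _).symm

theorem sum_kronecker_pow_eq_zero {ι R p n : Type*} [Fintype ι] [CommSemiring R] [Fintype p]
    [DecidableEq p] [Fintype n] [DecidableEq n] {m : ℕ} (A : ι → Matrix p p R)
    (B : ι → Matrix n n R) (h : ∀ w : Fin m → ι, (List.ofFn fun i => A (w i)).prod = 0) :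
    (∑ j, kroneckerMap (· * ·) (A j) (B j)) ^ m = 0 := by
  rw [sum_pow_eq_sum_prod_ofFn]
  refine Finset.sum_eq_zero fun w _ => ?_
  have hw := prod_map_kronecker A B (List.ofFn w)
  simp only [List.map_ofFn, Function.comp_def, h w] at hw
  rw [hw]
  exact Matrix.zero_kronecker _

theorem det_one_sub_of_isNilpotent {R n : Type*} [CommRing R] [IsDomain R] [Fintype n]
    [DecidableEq n] {M : Matrix n n R} (hM : IsNilpotent M) : (1 - M).det = 1 := by
  have h := (Matrix.isNilpotent_charpoly_sub_pow_of_isNilpotent hM).eq_zero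
  have h1 := Matrix.eval_charpoly M 1
  rw [sub_eq_zero.mp h] at h1
  simpa using h1.symm

/-- The determinant of a finite-rank perturbation of `1 - L` with `L` nilpotent, with `(1 - L)⁻¹`
written as a geometric sum. -/
theorem det_one_sub_sub_mul {R p n : Type*} [CommRing R] [IsDomain R] [Fintype p]
    [DecidableEq p] [Fintype n] [DecidableEq n] {m : ℕ} {L : Matrix p p R} (hL : L ^ m = 0)
    (B : Matrix p n R) (C : Matrix n p R) :
    (1 - (L + B * C)).det = (1 - C * (∑ i ∈ Finset.range m, L ^ i) * B).det := by
  have hgeom : (1 - L) * ∑ i ∈ Finset.range m, L ^ i = 1 := by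
    rw [mul_neg_geom_sum, hL, sub_zero]
  have hfac : 1 - (L + B * C) =
      (1 - L) * (1 - (∑ i ∈ Finset.range m, L ^ i) * B * C) := by
    rw [mul_sub, mul_one, ← Matrix.mul_assoc, ← Matrix.mul_assoc, hgeom, Matrix.one_mul,
      sub_sub]
  rw [hfac, det_mul, det_one_sub_of_isNilpotent ⟨m, hL⟩, one_mul, Matrix.det_one_sub_mul_comm,
    Matrix.mul_assoc]

theorem lift_linPart_pow_apply {k : Type*} [CommRing k] {g d n : ℕ}
    (N : Fin g → Matrix (Fin d) (Fin d) k) (X : Fin g → Matrix (Fin n) (Fin n) k) (i : ℕ)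
    (a e : Fin d) (p q : Fin n) :
    FreeAlgebra.lift k X ((linPart N ^ i) a e) p q =
      ((∑ j, kroneckerMap (· * ·) (N j) (X j)) ^ i) (a, p) (e, q) := by
  have h : Matrix.compRingEquiv (Fin d) (Fin n) k
      ((FreeAlgebra.lift k X).toRingHom.mapMatrix (linPart N)) =
        ∑ j, kroneckerMap (· * ·) (N j) (X j) := by
    ext ⟨a, p⟩ ⟨e, q⟩
    simp [linPart, Matrix.sum_apply]
  rw [← h, ← map_pow, ← map_pow]
  rfl

/-- The determinant identity behind Fornasini–Marchesini realizations: the free locus of the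
polynomial `f = 1 - cᵀ(I - Λ)⁻¹ b` is cut out by the monic pencil with coefficients
`N j + b j ⬝ cᵀ`. -/
theorem det_fmPoly_eq_det_pencil
    {k : Type*} [Field k] [IsAlgClosed k] [CharZero k] {g d m : ℕ}
    (N : Fin g → Matrix (Fin d) (Fin d) k) (b : Fin g → Fin d → k) (c : Fin d → k)
    (hnil : ∀ w : Fin m → Fin g, (List.ofFn fun i => N (w i)).prod = 0) :
    ∀ (n : ℕ) (X : Fin g → Matrix (Fin n) (Fin n) k),
      (scalarEval (fmPoly m N b c) X).det =
        (pencilEval (fun j => N j + Matrix.vecMulVec (b j) c) X).det := by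
  intro n X
  set L := ∑ j, kroneckerMap (· * ·) (N j) (X j) with hLdef
  let B : Matrix (Fin d × Fin n) (Fin n) k := of fun p q => ∑ j, b j p.1 * X j p.2 q
  let C : Matrix (Fin n) (Fin d × Fin n) k :=
    of fun p q => c q.1 * (1 : Matrix (Fin n) (Fin n) k) p q.2
  have hpencil : pencilEval (fun j => N j + Matrix.vecMulVec (b j) c) X = 1 - (L + B * C) := by
    rw [pencilEval]
    congr 1
    ext ⟨a, p⟩ ⟨e, q⟩
    simp only [L, B, C, Matrix.sum_apply, Matrix.add_apply, Matrix.mul_apply, of_apply,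
      kroneckerMap_apply, map_apply, Algebra.algebraMap_self, RingHom.id_apply, vecMulVec_apply,
      Matrix.one_apply, mul_ite, mul_one, mul_zero, Finset.sum_ite_eq', Finset.mem_univ, if_true,
      add_mul, Finset.sum_add_distrib, Finset.sum_mul]
    exact congrArg _ (Finset.sum_congr rfl fun j _ => by ring)
  have hpoly : scalarEval (fmPoly m N b c) X =
      1 - C * (∑ i ∈ Finset.range m, L ^ i) * B := by
    rw [scalarEval, fmPoly, map_sub, map_one, Matrix.mul_sum, Matrix.sum_mul, map_sum]
    congr 1
    refine Finset.sum_congr rfl fun i _ => ?_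
    ext p q
    have hC (s : Fin d × Fin n) : (C * L ^ i) p s = ∑ a, c a * (L ^ i) (a, p) s := by
      simp [C, Matrix.mul_apply, Fintype.sum_prod_type, Matrix.one_apply]
    rw [Matrix.mul_apply]
    simp only [hC, B, of_apply, Fintype.sum_prod_type, map_sum, map_smul, map_mul,
      FreeAlgebra.lift_ι_apply, Matrix.sum_apply, Matrix.smul_apply, smul_eq_mul,
      Matrix.mul_apply (M := FreeAlgebra.lift k X _), lift_linPart_pow_apply, ← hLdef,
      Finset.sum_mul, Finset.mul_sum (s := (Finset.univ : Finset (Fin n)))]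
    rw [Finset.sum_comm]
    refine Finset.sum_congr rfl fun e _ => ?_
    rw [Finset.sum_comm]
    simp only [mul_assoc]
  rw [hpencil, hpoly, det_one_sub_sub_mul (sum_kronecker_pow_eq_zero N X hnil)]
end
end

section
/- Let k be an algebraically closed field of characteristic zero and let L = I_d − Σ_{j=1}^g A_j x_j be an irreducible monic linear pencil (A₁,…,A_g generate M_d(k) as a unital k-algebra) that is not flip-poly. Then for every f ∈ k⟨x₁,…,x_g⟩ the free loci differ: it is not the case that for all n ∈ ℕ and all X ∈ M_n(k)^g, det L(X) = 0 ⇔ det f(X) = 0. -/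
open Matrix MvPolynomial

noncomputable section

/-- A monic pencil `I - ∑ j, A j x j` is flip-poly if `A j = N j + b j ⬝ cᵀ` with `N` jointly
nilpotent and `b j ⬝ cᵀ` rank-one matrices with common kernel. -/
def FlipPoly {k : Type*} [Field k] {g d : ℕ} (A : Fin g → Matrix (Fin d) (Fin d) k) : Prop :=
  ∃ (N : Fin g → Matrix (Fin d) (Fin d) k) (b : Fin g → Fin d → k) (c : Fin d → k),
    (∃ m : ℕ, ∀ w : Fin m → Fin g, (List.ofFn fun i => N (w i)).prod = 0) ∧
    ∀ j, A j = N j + Matrix.vecMulVec (b j) c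

section Filtration

variable {k : Type*} [Field k] {g d : ℕ}

/-- A functional on a space descends along a linear map if it vanishes on the part of the kernel
lying in a given subspace. -/
lemma exists_functional_of_ker_le {E V : Type*} [AddCommGroup E] [Module k E] [AddCommGroup V]
    [Module k V] (π : E →ₗ[k] V) (γ : E →ₗ[k] k) (F : Submodule k E)
    (h : ∀ r ∈ F, π r = 0 → γ r = 0) : ∃ c : V →ₗ[k] k, ∀ r ∈ F, c (π r) = γ r := by
  have hmem : γ.domRestrict F ∈ LinearMap.range (π.domRestrict F).dualMap := by
    rw [LinearMap.range_dualMap_eq_dualAnnihilator_ker, Submodule.mem_dualAnnihilator]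
    intro r hr
    exact h r r.2 hr
  obtain ⟨c, hc⟩ := hmem
  exact ⟨c, fun r hr => LinearMap.congr_fun hc ⟨r, hr⟩⟩

/-- A tuple is flip-poly if it lowers a filtration by one step on a hyperplane. -/
lemma flipPoly_of_hyperplane_filtration (A : Fin g → Matrix (Fin d) (Fin d) k)
    (c : (Fin d → k) →ₗ[k] k) (G : ℕ → Submodule k (Fin d → k)) (hmono : Monotone G) (M : ℕ)
    (h0 : ∀ x ∈ G 0, x = 0) (htop : ∀ x, x ∈ G M)
    (hstep : ∀ m < M, ∀ j, ∀ x ∈ G (m + 1), c x = 0 → A j *ᵥ x ∈ G m) : FlipPoly A := by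
  classical
  obtain ⟨v, hv⟩ : ∃ v, ∀ m, ∀ x ∈ G m, x - c x • v ∈ G m ∧ c (x - c x • v) = 0 := by
    by_cases hc : ∃ m, ∃ v ∈ G m, c v ≠ 0
    · obtain ⟨v, hvG, hv⟩ := Nat.find_spec hc
      refine ⟨(c v)⁻¹ • v, fun m x hx => ?_⟩
      have hcx : c (x - c x • (c v)⁻¹ • v) = 0 := by simp [hv]
      refine ⟨?_, hcx⟩
      by_cases hx0 : c x = 0
      · simpa [hx0] using hx
      · have hle : Nat.find hc ≤ m := Nat.find_min' hc ⟨x, hx, hx0⟩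
        exact sub_mem hx (Submodule.smul_mem _ _ (Submodule.smul_mem _ _ (hmono hle hvG)))
    · push Not at hc
      exact ⟨0, fun m x hx => by simpa using ⟨hx, hc m x hx⟩⟩
  let c' : Fin d → k := fun i => c (Pi.single i 1)
  have hc' : ∀ x, c' ⬝ᵥ x = c x := by
    intro x
    conv_rhs => rw [pi_eq_sum_univ' x]
    simp [c', dotProduct, mul_comm, Pi.single, map_sum]
  let N : Fin g → Matrix (Fin d) (Fin d) k := fun j => A j - vecMulVec (A j *ᵥ v) c'
  have hN : ∀ j x, N j *ᵥ x = A j *ᵥ (x - c x • v) := by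
    intro j x
    simp only [N, sub_mulVec, vecMulVec_mulVec, hc', mulVec_sub, mulVec_smul]
    simp
  have hNG : ∀ m < M, ∀ j, ∀ x ∈ G (m + 1), N j *ᵥ x ∈ G m := by
    intro m hm j x hx
    rw [hN]
    exact hstep m hm j _ (hv _ x hx).1 (hv _ x hx).2
  have hprod : ∀ m ≤ M, ∀ w : Fin m → Fin g, ∀ x ∈ G m,
      (List.ofFn fun i => N (w i)).prod *ᵥ x = 0 := by
    intro m
    induction m with
    | zero => intro _ w x hx; simp [h0 x hx]
    | succ m ih =>
      intro hm w x hx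
      rw [List.ofFn_succ', List.concat_eq_append, List.prod_append, List.prod_singleton,
        ← mulVec_mulVec]
      exact ih (by omega) _ _ (hNG m (by omega) _ x hx)
  refine ⟨N, fun j => A j *ᵥ v, c', ⟨M, fun w => ?_⟩, fun j => by simp [N]⟩
  refine Matrix.ext_of_mulVec_single fun i => ?_
  rw [hprod M le_rfl w _ (htop _), zero_mulVec]

/-- Flip-polyness passes to quotients, in the form needed for subquotients of a module with a
filtration. -/
lemma flipPoly_of_filtration (A : Fin g → Matrix (Fin d) (Fin d) k)
    {E : Type*} [AddCommGroup E] [Module k E] (π : E →ₗ[k] (Fin d → k)) (γ : E →ₗ[k] k)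
    (X : Fin g → E → E) (hX : ∀ j r, π (X j r) = A j *ᵥ π r) (F : ℕ → Submodule k E)
    (hmono : Monotone F) (M : ℕ) (h0 : ∀ r ∈ F 0, π r = 0 ∧ γ r = 0)
    (htop : ∀ y, ∃ r ∈ F M, π r = y)
    (hstep : ∀ m j, ∀ r ∈ F (m + 1), γ r = 0 → X j r ∈ F m) : FlipPoly A := by
  classical
  let Q : ℕ → Prop := fun m => ∀ r ∈ F m, π r = 0 → γ r = 0
  have hQ : Q (Nat.findGreatest Q M) :=
    Nat.findGreatest_spec (Nat.zero_le M) fun r hr _ => (h0 r hr).2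
  obtain ⟨c, hc⟩ := exists_functional_of_ker_le π γ _ hQ
  refine flipPoly_of_hyperplane_filtration A c (fun m => (F m).map π)
    (fun a b hab => Submodule.map_mono (hmono hab)) M ?_ ?_ ?_
  · rintro _ ⟨r, hr, rfl⟩
    exact (h0 r hr).1
  · exact htop
  · rintro m hm j _ ⟨r, hr, rfl⟩ hcr
    obtain ⟨r', hr', hπ, hγ⟩ : ∃ r' ∈ F (m + 1), π r' = π r ∧ γ r' = 0 := by
      by_cases hle : m + 1 ≤ Nat.findGreatest Q M
      · exact ⟨r, hr, rfl, by rw [← hc r (hmono hle hr), hcr]⟩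
      · have hnot : ¬ Q (m + 1) := Nat.findGreatest_is_greatest (n := M) (by omega) (by omega)
        simp only [Q] at hnot
        push Not at hnot
        obtain ⟨t, ht, hπt, hγt⟩ := hnot
        exact ⟨r - (γ r * (γ t)⁻¹) • t, sub_mem hr (Submodule.smul_mem _ _ ht), by simp [hπt],
          by simp [hγt]⟩
    exact ⟨X j r', hstep m j r' hr' hγ, by rw [hX, hπ]⟩

end Filtration

/-- A realization `p = cᵀ (1 - ∑ j, N j x j)⁻¹ (∑ j, b j x j)` of a noncommutative polynomial,
with `N` strictly triangular with respect to the rank function `ρ`; `u` is the vector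
`(1 - ∑ j, N j x j)⁻¹ (∑ j, b j x j)`. -/
structure NilpotentRealization {k : Type*} [Field k] {g : ℕ} (p : FreeAlgebra k (Fin g))
    (ι : Type) [Fintype ι] where
  ρ : ι → ℕ
  N : Fin g → Matrix ι ι k
  b : Fin g → ι → k
  c : ι → k
  u : ι → FreeAlgebra k (Fin g)
  rank_lt : ∀ j i i', N j i i' ≠ 0 → ρ i < ρ i'
  state_eq : ∀ i, u i = ∑ j, FreeAlgebra.ι k j *
    (algebraMap k _ (b j i) + ∑ i', N j i i' • u i')
  output_eq : p = ∑ i, c i • u i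

namespace NilpotentRealization

variable {k : Type*} [Field k] {g : ℕ} {p q : FreeAlgebra k (Fin g)} {ι κ : Type} [Fintype ι]
  [Fintype κ]

/-- The coefficient tuple of the flip-poly pencil attached to a realization. -/
def coeff (P : NilpotentRealization p ι) (j : Fin g) : Matrix ι ι k :=
  P.N j + vecMulVec (P.b j) P.c

def reindex (P : NilpotentRealization p ι) (e : κ ≃ ι) : NilpotentRealization p κ where
  ρ i := P.ρ (e i)
  N j := (P.N j).submatrix e e
  b j i := P.b j (e i)
  c i := P.c (e i)
  u i := P.u (e i)
  rank_lt _ _ _ h := P.rank_lt _ _ _ h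
  state_eq i := by
    rw [P.state_eq]
    refine Finset.sum_congr rfl fun j _ => ?_
    rw [← e.sum_comp]
    rfl
  output_eq := by
    rw [e.sum_comp fun i => P.c i • P.u i]
    exact P.output_eq

def zero : NilpotentRealization (0 : FreeAlgebra k (Fin g)) Empty where
  ρ := Empty.elim
  N _ := 0
  b _ := Empty.elim
  c := Empty.elim
  u := Empty.elim
  rank_lt _ i := i.elim
  state_eq i := i.elim
  output_eq := by simp

def var (j : Fin g) : NilpotentRealization (FreeAlgebra.ι k j) Unit where
  ρ _ := 0
  N _ := 0
  b j' _ := if j' = j then 1 else 0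
  c _ := 1
  u _ := FreeAlgebra.ι k j
  rank_lt _ _ _ h := absurd rfl h
  state_eq i := by
    rw [Finset.sum_eq_single j] <;> simp +contextual
  output_eq := by simp

def smul (a : k) (P : NilpotentRealization p ι) : NilpotentRealization (a • p) ι where
  __ := P
  c i := a * P.c i
  output_eq := by
    conv_lhs => rw [P.output_eq]
    simp [Finset.smul_sum, mul_smul]

def add (P : NilpotentRealization p ι) (Q : NilpotentRealization q κ) :
    NilpotentRealization (p + q) (ι ⊕ κ) where
  ρ := Sum.elim P.ρ Q.ρ
  N j := fromBlocks (P.N j) 0 0 (Q.N j)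
  b j := Sum.elim (P.b j) (Q.b j)
  c := Sum.elim P.c Q.c
  u := Sum.elim P.u Q.u
  rank_lt j i i' h := by
    rcases i with i | i <;> rcases i' with i' | i' <;> simp at h
    · exact P.rank_lt j i i' h
    · exact Q.rank_lt j i i' h
  state_eq i := by
    rcases i with i | i
    · simpa using P.state_eq i
    · simpa using Q.state_eq i
  output_eq := by
    conv_lhs => rw [P.output_eq, Q.output_eq]
    simp

def varMul (j₀ : Fin g) (P : NilpotentRealization p ι) :
    NilpotentRealization (FreeAlgebra.ι k j₀ * p) (Option ι) where
  ρ i := i.elim 0 fun i => P.ρ i + 1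
  N j i i' := i'.elim 0 fun i' => i.elim (if j = j₀ then P.c i' else 0) fun i => P.N j i i'
  b j i := i.elim 0 (P.b j)
  c i := i.elim 1 fun _ => 0
  u i := i.elim (FreeAlgebra.ι k j₀ * p) P.u
  rank_lt j i i' h := by
    rcases i' with _ | i'
    · exact absurd rfl h
    · rcases i with _ | i
      · simp
      · simpa using P.rank_lt j i i' h
  state_eq i := by
    rcases i with _ | i
    · rw [Finset.sum_eq_single j₀]
      · simpa using congrArg (FreeAlgebra.ι k j₀ * ·) P.output_eq
      · intro j _ hj
        simp [hj]
      · simp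
    · simpa using P.state_eq i
  output_eq := by simp

end NilpotentRealization

section Realization

variable {k : Type*} [Field k] {g : ℕ}

lemma exists_realization_mul (q : FreeAlgebra k (Fin g)) :
    ∀ p : FreeAlgebra k (Fin g),
      (∃ (ι : Type) (_ : Fintype ι), Nonempty (NilpotentRealization p ι)) →
      ∃ (ι : Type) (_ : Fintype ι), Nonempty (NilpotentRealization (q * p) ι) := by
  induction q using FreeAlgebra.induction with
  | grade0 a =>
    rintro p ⟨ι, _, ⟨P⟩⟩
    rw [← Algebra.smul_def]
    exact ⟨ι, _, ⟨P.smul a⟩⟩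
  | grade1 j =>
    rintro p ⟨ι, _, ⟨P⟩⟩
    exact ⟨Option ι, inferInstance, ⟨P.varMul j⟩⟩
  | mul a b ha hb =>
    intro p hp
    rw [mul_assoc]
    exact ha _ (hb _ hp)
  | add a b ha hb =>
    intro p hp
    obtain ⟨ι, _, ⟨P⟩⟩ := ha p hp
    obtain ⟨κ, _, ⟨Q⟩⟩ := hb p hp
    rw [add_mul]
    exact ⟨ι ⊕ κ, inferInstance, ⟨P.add Q⟩⟩

lemma exists_realization_sub (q : FreeAlgebra k (Fin g)) :
    ∃ (ι : Type) (_ : Fintype ι), Nonempty (NilpotentRealization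
      (q - algebraMap k _ (FreeAlgebra.algebraMapInv q)) ι) := by
  induction q using FreeAlgebra.induction with
  | grade0 a =>
    refine ⟨Empty, inferInstance, ⟨?_⟩⟩
    rw [AlgHom.commutes, Algebra.algebraMap_self_apply, sub_self]
    exact .zero
  | grade1 j =>
    refine ⟨Unit, inferInstance, ⟨?_⟩⟩
    have h : FreeAlgebra.algebraMapInv (FreeAlgebra.ι k j) = (0 : k) := by
      simp [FreeAlgebra.algebraMapInv]
    rw [h, map_zero, sub_zero]
    exact .var j
  | mul a b ha hb =>
    obtain ⟨ι, _, ⟨P⟩⟩ := exists_realization_mul a _ hb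
    obtain ⟨κ, _, ⟨Q⟩⟩ := ha
    refine ⟨ι ⊕ κ, inferInstance, ⟨?_⟩⟩
    convert P.add (Q.smul (FreeAlgebra.algebraMapInv b)) using 1
    rw [map_mul, map_mul, smul_sub, Algebra.smul_def, Algebra.smul_def, mul_sub,
      Algebra.commutes _ a, Algebra.commutes (FreeAlgebra.algebraMapInv b) (algebraMap k _ _)]
    abel
  | add a b ha hb =>
    obtain ⟨ι, _, ⟨P⟩⟩ := ha
    obtain ⟨κ, _, ⟨Q⟩⟩ := hb
    refine ⟨ι ⊕ κ, inferInstance, ⟨?_⟩⟩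
    convert P.add Q using 1
    rw [map_add, map_add]
    abel

/-- Every noncommutative polynomial without constant term has a nilpotent realization. -/
lemma exists_realization (p : FreeAlgebra k (Fin g)) (hp : FreeAlgebra.algebraMapInv p = (0 : k)) :
    ∃ n : ℕ, Nonempty (NilpotentRealization p (Fin n)) := by
  obtain ⟨ι, _, ⟨P⟩⟩ := exists_realization_sub p
  rw [hp, map_zero, sub_zero] at P
  exact ⟨_, ⟨P.reindex (Fintype.equivFin ι).symm⟩⟩

/-- Singularity of `1 - ∑ j, A j ⊗ B j`, in a form symmetric in `A` and `B`. -/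
def HasFixedTensor {ι κ : Type} [Fintype ι] [Fintype κ] (A : Fin g → Matrix ι ι k)
    (B : Fin g → Matrix κ κ k) : Prop :=
  ∃ z : ι → κ → k, z ≠ 0 ∧ ∀ i a, z i a = ∑ j, ∑ i', ∑ a', A j i i' * B j a a' * z i' a'

lemma HasFixedTensor.symm {ι κ : Type} [Fintype ι] [Fintype κ] {A : Fin g → Matrix ι ι k}
    {B : Fin g → Matrix κ κ k} (h : HasFixedTensor A B) : HasFixedTensor B A := by
  obtain ⟨z, hz, h⟩ := h
  refine ⟨fun a i => z i a, fun h0 => hz (by ext i a; exact congrFun (congrFun h0 a) i),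
    fun a i => (h i a).trans ?_⟩
  refine Finset.sum_congr rfl fun j _ => ?_
  rw [Finset.sum_comm]
  simp only [mul_comm (A j _ _)]

lemma det_pencilEval_eq_zero_iff {d n : ℕ} (A : Fin g → Matrix (Fin d) (Fin d) k)
    (X : Fin g → Matrix (Fin n) (Fin n) k) :
    (pencilEval A X).det = 0 ↔ HasFixedTensor A X := by
  rw [← Matrix.exists_mulVec_eq_zero_iff]
  have key : ∀ v : Fin d × Fin n → k, pencilEval A X *ᵥ v = 0 ↔
      ∀ i a, v (i, a) = ∑ j, ∑ i', ∑ a', A j i i' * X j a a' * v (i', a') := by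
    intro v
    rw [pencilEval, sub_mulVec, one_mulVec, sub_eq_zero, funext_iff, Prod.forall]
    refine forall_congr' fun i => forall_congr' fun a => ?_
    rw [sum_mulVec, Finset.sum_apply]
    simp [mulVec, dotProduct, Fintype.sum_prod_type]
  constructor
  · rintro ⟨v, hv, h⟩
    exact ⟨fun i a => v (i, a), fun h0 => hv (by ext ⟨i, a⟩; exact congrFun (congrFun h0 i) a),
      (key v).1 h⟩
  · rintro ⟨z, hz, h⟩
    exact ⟨fun x => z x.1 x.2, fun h0 => hz (by ext i a; exact congrFun h0 (i, a)),
      (key _).2 h⟩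

variable {p : FreeAlgebra k (Fin g)} {ι κ : Type} [Fintype ι] [Fintype κ]

lemma NilpotentRealization.fixed_eq_iff (P : NilpotentRealization p ι) (B : Fin g → Matrix κ κ k)
    (z : ι → κ → k) (i : ι) :
    (∀ a, z i a = ∑ j, ∑ i', ∑ a', P.coeff j i i' * B j a a' * z i' a') ↔
      z i = ∑ j, B j *ᵥ (P.b j i • ∑ i', P.c i' • z i' + ∑ i', P.N j i i' • z i') := by
  rw [funext_iff]
  refine forall_congr' fun a => ?_
  have : ∀ j, P.b j i • ∑ i', P.c i' • z i' + ∑ i', P.N j i i' • z i' =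
      ∑ i', P.coeff j i i' • z i' := by
    intro j
    simp [coeff, vecMulVec_apply, add_smul, Finset.sum_add_distrib, Finset.smul_sum, mul_smul,
      add_comm]
  simp only [this, Finset.sum_apply, mulVec_sum, mulVec_smul, Pi.smul_apply, smul_eq_mul, mulVec,
    dotProduct, Finset.mul_sum, mul_assoc]

variable [DecidableEq κ]

lemma NilpotentRealization.lift_state_mulVec (P : NilpotentRealization p ι)
    (B : Fin g → Matrix κ κ k) (ξ : κ → k) (i : ι) :
    FreeAlgebra.lift k B (P.u i) *ᵥ ξ =
      ∑ j, B j *ᵥ (P.b j i • ξ + ∑ i', P.N j i i' • FreeAlgebra.lift k B (P.u i') *ᵥ ξ) := by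
  conv_lhs => rw [P.state_eq]
  simp only [map_sum, map_mul, map_add, map_one, FreeAlgebra.lift_ι_apply, map_smul, sum_mulVec,
    ← mulVec_mulVec, add_mulVec, smul_mulVec, Algebra.algebraMap_eq_smul_one, one_mulVec]

lemma NilpotentRealization.lift_output_mulVec (P : NilpotentRealization p ι)
    (B : Fin g → Matrix κ κ k) (ξ : κ → k) :
    FreeAlgebra.lift k B p *ᵥ ξ = ∑ i, P.c i • FreeAlgebra.lift k B (P.u i) *ᵥ ξ := by
  conv_lhs => rw [P.output_eq]
  simp only [map_sum, map_smul, sum_mulVec, smul_mulVec]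

/-- If `1 - p(B)` is singular, then so is the pencil of a realization of `p` at `B`. -/
lemma NilpotentRealization.hasFixedTensor (P : NilpotentRealization p ι)
    (B : Fin g → Matrix κ κ k) (ξ : κ → k) (hξ : ξ ≠ 0)
    (h : FreeAlgebra.lift k B p *ᵥ ξ = ξ) : HasFixedTensor P.coeff B := by
  have hout : ∑ i, P.c i • FreeAlgebra.lift k B (P.u i) *ᵥ ξ = ξ := by
    rw [← P.lift_output_mulVec, h]
  refine ⟨fun i => FreeAlgebra.lift k B (P.u i) *ᵥ ξ, fun h0 => hξ ?_, fun i => ?_⟩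
  · rw [← hout]
    exact Finset.sum_eq_zero fun i _ => by rw [congrFun h0 i]; simp
  · rw [P.fixed_eq_iff B (fun i => FreeAlgebra.lift k B (P.u i) *ᵥ ξ) i, hout]
    exact P.lift_state_mulVec B ξ i

/-- If the pencil of a realization of `p` is singular at `B`, then so is `1 - p(B)`. -/
lemma NilpotentRealization.exists_fixed (P : NilpotentRealization p ι)
    (B : Fin g → Matrix κ κ k) (h : HasFixedTensor P.coeff B) :
    ∃ ξ ≠ 0, FreeAlgebra.lift k B p *ᵥ ξ = ξ := by
  obtain ⟨z, hz, h⟩ := h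
  set ξ := ∑ i, P.c i • z i with hξ
  have hz' : ∀ i, z i = ∑ j, B j *ᵥ (P.b j i • ξ + ∑ i', P.N j i i' • z i') := fun i =>
    (P.fixed_eq_iff B z i).1 (h i)
  have huniq : ∀ t i, Finset.univ.sup P.ρ < P.ρ i + t →
      z i = FreeAlgebra.lift k B (P.u i) *ᵥ ξ := by
    intro t
    induction t with
    | zero => exact fun i hi => absurd (Finset.le_sup (f := P.ρ) (Finset.mem_univ i)) (by omega)
    | succ t ih =>
      intro i hi
      rw [hz', P.lift_state_mulVec]
      refine Finset.sum_congr rfl fun j _ => ?_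
      congr 2
      refine Finset.sum_congr rfl fun i' _ => ?_
      by_cases hN : P.N j i i' = 0
      · simp [hN]
      · have := P.rank_lt j i i' hN
        rw [ih i' (by omega)]
  have hzu : ∀ i, z i = FreeAlgebra.lift k B (P.u i) *ᵥ ξ := fun i =>
    huniq (Finset.univ.sup P.ρ + 1) i (by omega)
  refine ⟨ξ, fun h0 => hz ?_, ?_⟩
  · ext1 i
    rw [hzu, h0, mulVec_zero, Pi.zero_apply]
  · rw [P.lift_output_mulVec, hξ]
    exact Finset.sum_congr rfl fun i _ => by rw [← hξ, ← hzu]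

end Realization

section Irreducible

variable {k : Type*} [Field k] {g d : ℕ}

/-- In a matrix algebra that is generated by `A`, the two-sided ideal generated by the value of
a polynomial with `r(A) ≠ 0` contains the identity. -/
lemma exists_sum_mul_mul_eq_one (A : Fin g → Matrix (Fin d) (Fin d) k)
    (hsurj : Function.Surjective (FreeAlgebra.lift k A)) (r : FreeAlgebra k (Fin g))
    (hr : FreeAlgebra.lift k A r ≠ 0) :
    ∃ a b : Fin d → FreeAlgebra k (Fin g), FreeAlgebra.lift k A (∑ i, a i * r * b i) = 1 := by
  obtain ⟨s, t, hst⟩ : ∃ s t, FreeAlgebra.lift k A r s t ≠ 0 := by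
    by_contra! h
    exact hr (Matrix.ext h)
  choose a ha using fun i : Fin d =>
    hsurj (Matrix.single i s (FreeAlgebra.lift k A r s t)⁻¹)
  choose b hb using fun i : Fin d => hsurj (Matrix.single t i 1)
  refine ⟨a, b, ?_⟩
  simp only [map_sum, map_mul, ha, hb, Matrix.single_mul_mul_single, inv_mul_cancel₀ hst, mul_one]
  exact Matrix.sum_single_one

/-- If the kernel of the representation `B` is contained in that of the irreducible
representation `A`, and `B` is given by a nilpotent realization, then `A` is flip-poly. -/
lemma flipPoly_of_realization (A : Fin g → Matrix (Fin d) (Fin d) k)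
    (hsurj : Function.Surjective (FreeAlgebra.lift k A)) {p : FreeAlgebra k (Fin g)} {n : ℕ}
    (P : NilpotentRealization p (Fin n)) {σ : Fin d → k} (hσ : σ ≠ 0)
    (hker : ∀ r, FreeAlgebra.lift k P.coeff r = 0 → FreeAlgebra.lift k A r = 0) : FlipPoly A := by
  classical
  let S : Finset (Fin n) → Set (FreeAlgebra k (Fin g)) := fun s =>
    {r | ∀ a ∈ s, FreeAlgebra.lift k P.coeff r *ᵥ Pi.single a 1 = 0}
  obtain ⟨s, e, ⟨r₀, hr₀, hr₀σ⟩, hins⟩ : ∃ s e, (∃ r ∈ S s, FreeAlgebra.lift k A r *ᵥ σ ≠ 0) ∧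
      ∀ r ∈ S (insert e s), FreeAlgebra.lift k A r *ᵥ σ = 0 := by
    by_contra! hcon
    have : ∀ s : Finset (Fin n), ∃ r ∈ S s, FreeAlgebra.lift k A r *ᵥ σ ≠ 0 := by
      intro s
      induction s using Finset.induction with
      | empty => exact ⟨1, by simp [S], by simpa using hσ⟩
      | insert e s _ ih => exact hcon s e ih
    obtain ⟨r, hr, hrσ⟩ := this Finset.univ
    have h0 : FreeAlgebra.lift k P.coeff r = 0 :=
      Matrix.ext_of_mulVec_single fun i => by rw [hr i (Finset.mem_univ i), zero_mulVec]
    simp [hker r h0] at hrσ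
  let θ : FreeAlgebra k (Fin g) →ₗ[k] (Fin n → k) :=
    (Matrix.mulVecBilin k k).flip (Pi.single e 1) ∘ₗ (FreeAlgebra.lift k P.coeff).toLinearMap
  have hθ : ∀ r, θ r = FreeAlgebra.lift k P.coeff r *ᵥ Pi.single e 1 := fun _ => rfl
  let π : FreeAlgebra k (Fin g) →ₗ[k] (Fin d → k) :=
    (Matrix.mulVecBilin k k).flip σ ∘ₗ (FreeAlgebra.lift k A).toLinearMap
  have hπ : ∀ r, π r = FreeAlgebra.lift k A r *ᵥ σ := fun _ => rfl
  let γ : FreeAlgebra k (Fin g) →ₗ[k] k := dotProductBilin k k P.c ∘ₗ θ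
  have hγ : ∀ r, γ r = P.c ⬝ᵥ θ r := fun _ => rfl
  let F : ℕ → Submodule k (FreeAlgebra k (Fin g)) := fun m =>
    { carrier := {r | r ∈ S s ∧ ∀ i, m ≤ P.ρ i → θ r i = 0}
      zero_mem' := ⟨fun a _ => by rw [map_zero, zero_mulVec], fun i _ => by simp⟩
      add_mem' := by
        rintro r r' ⟨h1, h2⟩ ⟨h1', h2'⟩
        refine ⟨fun a ha => ?_, fun i hi => ?_⟩
        · rw [map_add, add_mulVec, h1 a ha, h1' a ha, add_zero]
        · rw [map_add, Pi.add_apply, h2 i hi, h2' i hi, add_zero]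
      smul_mem' := by
        rintro t r ⟨h1, h2⟩
        refine ⟨fun a ha => ?_, fun i hi => ?_⟩
        · rw [map_smul, smul_mulVec, h1 a ha, smul_zero]
        · rw [map_smul, Pi.smul_apply, h2 i hi, smul_zero] }
  refine flipPoly_of_filtration A π γ (fun j r => FreeAlgebra.ι k j * r) ?_ F ?_
    (Finset.univ.sup P.ρ + 1) ?_ ?_ ?_
  · intro j r
    simp [hπ, mulVec_mulVec]
  · exact fun m m' hm r hr => ⟨hr.1, fun i hi => hr.2 i (hm.trans hi)⟩
  · rintro r ⟨hrS, hrθ⟩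
    have h0 : θ r = 0 := funext fun i => hrθ i (Nat.zero_le _)
    refine ⟨hins r ?_, by rw [hγ, h0, dotProduct_zero]⟩
    simp only [S, Finset.forall_mem_insert, Set.mem_ofPred_eq]
    exact ⟨h0, hrS⟩
  · intro y
    obtain ⟨i, hi⟩ := Function.ne_iff.1 hr₀σ
    obtain ⟨a, ha⟩ := hsurj (vecMulVec y (Pi.single i ((FreeAlgebra.lift k A r₀ *ᵥ σ) i)⁻¹))
    refine ⟨a * r₀, ⟨fun b hb => ?_, fun i hi => ?_⟩, ?_⟩
    · rw [map_mul, ← mulVec_mulVec, hr₀ b hb, mulVec_zero]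
    · exact absurd (Finset.le_sup (f := P.ρ) (Finset.mem_univ i)) (by omega)
    · rw [hπ, map_mul, ← mulVec_mulVec, ha, vecMulVec_mulVec, single_dotProduct,
        inv_mul_cancel₀ hi]
      simp
  · rintro m j r ⟨hrS, hrθ⟩ hr
    refine ⟨fun a ha => ?_, fun i hi => ?_⟩
    · rw [map_mul, ← mulVec_mulVec, hrS a ha, mulVec_zero]
    · have hstep : θ (FreeAlgebra.ι k j * r) = P.N j *ᵥ θ r := by
        rw [hθ, map_mul, FreeAlgebra.lift_ι_apply, ← mulVec_mulVec, ← hθ,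
          NilpotentRealization.coeff, add_mulVec, vecMulVec_mulVec, ← hγ, hr]
        simp
      rw [hstep, mulVec, dotProduct]
      refine Finset.sum_eq_zero fun i' _ => ?_
      by_cases hN : P.N j i i' = 0
      · rw [hN, zero_mul]
      · have := P.rank_lt j i i' hN
        rw [hrθ i' (by omega), mul_zero]

end Irreducible

/-- The free locus of an irreducible monic pencil that is not flip-poly is not the free locus
of any noncommutative polynomial. -/
theorem not_flipPoly_freeLocus_ne_polynomial
    {k : Type*} [Field k] [IsAlgClosed k] [CharZero k] {g d : ℕ}
    (A : Fin g → Matrix (Fin d) (Fin d) k)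
    (hirr : Algebra.adjoin k (Set.range A) = ⊤)
    (hnfp : ¬FlipPoly A) :
    ∀ f : FreeAlgebra k (Fin g),
      ¬∀ (n : ℕ) (X : Fin g → Matrix (Fin n) (Fin n) k),
        (pencilEval A X).det = 0 ↔ (scalarEval f X).det = 0 := by
  classical
  intro f hf
  have hsurj : Function.Surjective (FreeAlgebra.lift k A) := by
    rw [← AlgHom.range_eq_top, ← Algebra.adjoin_range_eq_range_freeAlgebra_lift, hirr]
  have hA : ∃ j, A j ≠ 0 := by
    by_contra! h
    exact hnfp ⟨0, 0, 0, ⟨1, fun w => by simp⟩, fun j => by simp [h j]⟩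
  obtain ⟨j₀, hj₀⟩ := hA
  have hσ : ∃ σ : Fin d → k, σ ≠ 0 := by
    by_contra! h
    exact hj₀ (Matrix.ext_of_mulVec_single fun i => by rw [h (Pi.single i 1)]; simp)
  obtain ⟨σ, hσ⟩ := hσ
  have hε : FreeAlgebra.algebraMapInv f ≠ 0 := by
    intro h0
    have hval : scalarEval f (0 : Fin g → Matrix (Fin 1) (Fin 1) k) = 0 := by
      have hhom : FreeAlgebra.lift k (0 : Fin g → Matrix (Fin 1) (Fin 1) k) =
          (Algebra.ofId k _).comp FreeAlgebra.algebraMapInv := by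
        ext j
        simp [FreeAlgebra.algebraMapInv]
      rw [scalarEval, hhom, AlgHom.comp_apply, h0, map_zero]
    have hdet := (hf 1 0).2 (by rw [hval]; simp)
    simp [pencilEval] at hdet
  set p : FreeAlgebra k (Fin g) := 1 - (FreeAlgebra.algebraMapInv f)⁻¹ • f with hp
  have hfp : f = FreeAlgebra.algebraMapInv f • (1 - p) := by
    rw [hp, sub_sub_cancel, smul_smul, mul_inv_cancel₀ hε, one_smul]
  obtain ⟨n, ⟨P⟩⟩ := exists_realization p (by simp [hp, hε])
  refine hnfp (flipPoly_of_realization A hsurj P hσ fun r hr => ?_)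
  by_contra hrA
  obtain ⟨a, b, hab⟩ := exists_sum_mul_mul_eq_one A hsurj r hrA
  obtain ⟨a', b', hab'⟩ := exists_sum_mul_mul_eq_one A hsurj (FreeAlgebra.ι k j₀) (by simpa)
  set q := (∑ i, a i * r * b i) * ∑ i, a' i * FreeAlgebra.ι k j₀ * b' i with hq
  have hqA : FreeAlgebra.lift k A q = 1 := by rw [hq, map_mul, hab, hab', one_mul]
  have hqP : FreeAlgebra.lift k P.coeff q = 0 := by simp [hq, hr]
  obtain ⟨m, ⟨Q⟩⟩ := exists_realization q (by simp [hq, FreeAlgebra.algebraMapInv])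
  have hdet : (pencilEval A Q.coeff).det = 0 :=
    (det_pencilEval_eq_zero_iff A Q.coeff).2
      (Q.hasFixedTensor A σ hσ (by rw [hqA, one_mulVec])).symm
  obtain ⟨ξ, hξ, hfξ⟩ := Matrix.exists_mulVec_eq_zero_iff.2 ((hf m Q.coeff).1 hdet)
  have hpξ : FreeAlgebra.lift k Q.coeff p *ᵥ ξ = ξ := by
    rw [scalarEval, hfp, map_smul, smul_mulVec, smul_eq_zero, map_sub, map_one, sub_mulVec,
      one_mulVec, sub_eq_zero] at hfξ
    exact (hfξ.resolve_left hε).symm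
  obtain ⟨η, hη, hqη⟩ := Q.exists_fixed P.coeff (P.hasFixedTensor Q.coeff ξ hξ hpξ).symm
  rw [hqP, zero_mulVec] at hqη
  exact hη hqη.symm
end
end

section
/- Let k be an algebraically closed field of characteristic zero and let f ∈ k⟨x₁,…,x_g, y₁,…,y_h⟩ (the free algebra on Fin g ⊕ Fin h generators) have constant term 1. Suppose that for every n ∈ ℕ, every X ∈ M_n(k)^g and all Y, Y' ∈ M_n(k)^h one has det f(X,Y) = det f(X,Y'). Then f lies in the image of the canonical unital k-algebra embedding k⟨x₁,…,x_g⟩ → k⟨x₁,…,x_g, y₁,…,y_h⟩, i.e. f is a noncommutative polynomial in x₁,…,x_g only. -/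
open Matrix

noncomputable section

namespace FreeAlgebra

theorem exists_finsupp_word {R α : Type*} [CommSemiring R] (f : FreeAlgebra R α) :
    ∃ c : List α →₀ R, c.sum (fun w a => a • (w.map (ι R)).prod) = f := by
  rw [← Finsupp.mem_span_range_iff_exists_finsupp]
  have hf : f ∈ Subalgebra.toSubmodule
      (Algebra.adjoin R (Set.range (ι R : α → FreeAlgebra R α))) := by
    rw [adjoin_range_ι]; trivial
  rw [Algebra.adjoin_eq_span] at hf
  refine Submodule.span_mono ?_ hf
  intro x hx
  induction hx using Submonoid.closure_induction with
  | mem x hx =>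
    obtain ⟨a, rfl⟩ := hx
    exact ⟨[a], by simp⟩
  | one => exact ⟨[], by simp⟩
  | mul x y _ _ hx hy =>
    obtain ⟨v, rfl⟩ := hx
    obtain ⟨w, rfl⟩ := hy
    exact ⟨v ++ w, by simp⟩

theorem lift_finsupp_word {R α A : Type*} [CommSemiring R] [Semiring A] [Algebra R A]
    (c : List α →₀ R) (Z : α → A) :
    lift R Z (c.sum fun w a => a • (w.map (ι R)).prod) = c.sum fun w a => a • (w.map Z).prod := by
  rw [map_finsuppSum]
  refine Finsupp.sum_congr fun w _ => ?_
  rw [map_smul, map_list_prod, List.map_map, ι_comp_lift]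

end FreeAlgebra

theorem List.prod_map_pow_smul {R A α : Type*} [CommSemiring R] [Semiring A] [Algebra R A]
    (s : R) (wt : α → ℕ) (Z : α → A) (w : List α) :
    (w.map fun a => s ^ wt a • Z a).prod = s ^ (w.map wt).sum • (w.map Z).prod := by
  induction w with
  | nil => simp
  | cons a w ih => simp [ih, pow_add, smul_smul, mul_comm]

/-- If the determinants of two evaluations of a noncommutative polynomial agree after every
rescaling of the generators by powers of `s` prescribed by `wt`, then so do the determinants of the
evaluations of its component of top weight. -/
theorem det_topWeight_eq {K α n : Type*} [Field K] [Infinite K] [Fintype n] [DecidableEq n]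
    (c : List α →₀ K) (wt : α → ℕ) (W : ℕ) (hW : ∀ w ∈ c.support, (w.map wt).sum ≤ W)
    (Z Z' : α → Matrix n n K)
    (hdet : ∀ s : K, (c.sum fun w a => a • (w.map fun i => s ^ wt i • Z i).prod).det =
      (c.sum fun w a => a • (w.map fun i => s ^ wt i • Z' i).prod).det) :
    (∑ w ∈ c.support with (w.map wt).sum = W, c w • (w.map Z).prod).det =
      (∑ w ∈ c.support with (w.map wt).sum = W, c w • (w.map Z').prod).det := by
  let G (Z : α → Matrix n n K) : Matrix n n (Polynomial K) :=
    ∑ w ∈ c.support, (Polynomial.X ^ (W - (w.map wt).sum) : Polynomial K) •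
      (c w • (w.map Z).prod).map Polynomial.C
  have hG (Z : α → Matrix n n K) (s : K) : (G Z).det.eval s =
      (∑ w ∈ c.support, s ^ (W - (w.map wt).sum) • c w • (w.map Z).prod).det := by
    rw [← Polynomial.coe_evalRingHom, RingHom.map_det]
    congr 1
    ext i j
    simp [G, Matrix.sum_apply]
  have hne (Z : α → Matrix n n K) (s : K) (hs : s ≠ 0) : (G Z).det.eval s =
      (s ^ W) ^ Fintype.card n *
        (c.sum fun w a => a • (w.map fun i => s⁻¹ ^ wt i • Z i).prod).det := by
    rw [hG, ← Matrix.det_smul, Finsupp.sum, Finset.smul_sum]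
    congr 1
    refine Finset.sum_congr rfl fun w hw => ?_
    rw [List.prod_map_pow_smul, smul_comm (c w), smul_smul (s ^ W), inv_pow,
      ← pow_sub₀ s hs (hW w hw)]
  have hzero (Z : α → Matrix n n K) : (G Z).det.eval 0 =
      (∑ w ∈ c.support with (w.map wt).sum = W, c w • (w.map Z).prod).det := by
    rw [hG, Finset.sum_filter]
    congr 1
    refine Finset.sum_congr rfl fun w hw => ?_
    have := hW w hw
    split_ifs with h
    · simp [h]
    · rw [zero_pow (by omega), zero_smul]
  have heq : (G Z).det = (G Z').det := by
    refine Polynomial.eq_of_infinite_eval_eq _ _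
      ((Set.finite_singleton (0 : K)).infinite_compl.mono ?_)
    intro s hs
    simp only [Set.mem_ofPred_eq]
    rw [hne Z s hs, hne Z' s hs, hdet]
  rw [← hzero, ← hzero, heq]

/-- The product of the weights `u` of the letters of a word placed at consecutive positions of a
cycle of length `d + 1`. -/
def cyclicWeight {R α : Type*} [CommSemiring R] {d : ℕ} (u : α → Fin (d + 1) → R) :
    List α → Fin (d + 1) → R
  | [], _ => 1
  | a :: w, i => u a i * cyclicWeight u w (i + 1)

theorem map_cyclicWeight {R S α : Type*} [CommSemiring R] [CommSemiring S] {d : ℕ} (φ : R →+* S)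
    (u : α → Fin (d + 1) → R) (w : List α) (i : Fin (d + 1)) :
    φ (cyclicWeight u w i) = cyclicWeight (fun a j => φ (u a j)) w i := by
  induction w generalizing i with
  | nil => simp [cyclicWeight]
  | cons a w ih => simp [cyclicWeight, ih]

theorem prod_map_diagonal_mul_shift {R α : Type*} [CommRing R] {d : ℕ}
    (u : α → Fin (d + 1) → R) (w : List α) :
    (w.map fun a => diagonal (u a) * (Equiv.addRight (1 : Fin (d + 1))).permMatrix R).prod =
      diagonal (cyclicWeight u w) * (Equiv.addRight (1 : Fin (d + 1))).permMatrix R ^ w.length := by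
  have hcomm (v : Fin (d + 1) → R) : (Equiv.addRight (1 : Fin (d + 1))).permMatrix R * diagonal v =
      diagonal (fun i => v (i + 1)) * (Equiv.addRight (1 : Fin (d + 1))).permMatrix R := by
    ext i j
    simp only [mul_diagonal, diagonal_mul, Equiv.Perm.permMatrix, PEquiv.toMatrix_apply]
    by_cases hij : i + 1 = j
    · simp [hij]
    · simp [hij]
  induction w with
  | nil =>
    ext i j
    simp [cyclicWeight, Matrix.one_apply]
  | cons a w ih =>
    rw [List.map_cons, List.prod_cons, ih, List.length_cons, pow_succ', mul_assoc,
      ← mul_assoc (Equiv.Perm.permMatrix R _), hcomm, ← mul_assoc, ← mul_assoc, ← mul_assoc,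
      diagonal_mul_diagonal]
    rfl

theorem cyclicWeight_indicator {R α : Type*} [CommSemiring R] [DecidableEq α] {d : ℕ}
    (w₀ : List α) (hw₀ : w₀.length = d) (i : Fin (d + 1)) (v : List α) (l : ℕ)
    (hv : l + v.length = d) :
    cyclicWeight (R := R) (fun a j => if w₀[(j - i).val]? = some a then 1 else 0) v
      (i + Fin.ofNat (d + 1) l) = if v = w₀.drop l then 1 else 0 := by
  induction v generalizing l with
  | nil =>
    simp only [List.length_nil, add_zero] at hv
    simp [cyclicWeight, hw₀, hv]
  | cons a v ih =>
    rw [List.length_cons] at hv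
    have hl : l < w₀.length := by omega
    have hpos : (i + Fin.ofNat (d + 1) l - i).val = l := by
      rw [add_sub_cancel_left, Fin.val_ofNat, Nat.mod_eq_of_lt (by omega)]
    have hsucc : i + Fin.ofNat (d + 1) l + 1 = i + Fin.ofNat (d + 1) (l + 1) := by
      rw [add_assoc]
      congr 1
      ext
      simp [Fin.val_add]
    rw [cyclicWeight, hsucc, ih (l + 1) (by omega), hpos, List.getElem?_eq_getElem hl,
      List.drop_eq_getElem_cons hl, ite_zero_mul_ite_zero, mul_one]
    simp only [Option.some_inj, List.cons_eq_cons, eq_comm (a := a)]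

/-- A nonzero homogeneous noncommutative polynomial over an infinite field has an invertible
evaluation at some tuple of matrices. -/
theorem exists_det_sum_words_ne_zero {K α : Type*} [Field K] [Infinite K] {d : ℕ}
    (T : Finset (List α)) (hT : T.Nonempty) (hlen : ∀ w ∈ T, w.length = d) (c : List α → K)
    (hc : ∀ w ∈ T, c w ≠ 0) :
    ∃ Z : α → Matrix (Fin (d + 1)) (Fin (d + 1)) K, (∑ w ∈ T, c w • (w.map Z).prod).det ≠ 0 := by
  classical
  let q (i : Fin (d + 1)) : MvPolynomial (α × Fin (d + 1)) K :=
    ∑ w ∈ T, MvPolynomial.C (c w) * cyclicWeight (fun a j => MvPolynomial.X (a, j)) w i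
  have hq (u : α × Fin (d + 1) → K) (i : Fin (d + 1)) : MvPolynomial.eval u (q i) =
      ∑ w ∈ T, c w * cyclicWeight (fun a j => u (a, j)) w i := by
    simp [q, map_cyclicWeight]
  obtain ⟨w₀, hw₀⟩ := hT
  have hq0 (i : Fin (d + 1)) : q i ≠ 0 := by
    intro h0
    have h := hq (fun p => if w₀[(p.2 - i).val]? = some p.1 then 1 else 0) i
    rw [h0, map_zero, Finset.sum_eq_single w₀] at h
    · have := cyclicWeight_indicator (R := K) w₀ (hlen _ hw₀) i w₀ 0 (by simp [hlen _ hw₀])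
      simp at this
      simp [this] at h
      exact hc _ hw₀ h.symm
    · intro w hw hne
      have := cyclicWeight_indicator (R := K) w₀ (hlen _ hw₀) i w 0 (by simp [hlen _ hw])
      simp [hne] at this
      simp [this]
    · exact fun h => absurd hw₀ h
  have hprod : ∏ i, q i ≠ 0 := Finset.prod_ne_zero_iff.mpr fun i _ => hq0 i
  obtain ⟨u, hu⟩ : ∃ u, MvPolynomial.eval u (∏ i, q i) ≠ 0 := by
    by_contra! h
    exact hprod (MvPolynomial.funext fun u => by rw [h u, map_zero])
  refine ⟨fun a => diagonal (fun i => u (a, i)) * (Equiv.addRight 1).permMatrix K, ?_⟩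
  have hsum : ∑ w ∈ T, c w • (w.map fun a => diagonal (fun i => u (a, i)) *
      (Equiv.addRight (1 : Fin (d + 1))).permMatrix K).prod =
      diagonal (fun i => MvPolynomial.eval u (q i)) *
        (Equiv.addRight (1 : Fin (d + 1))).permMatrix K ^ d := by
    have hdiag : diagonal (fun i => MvPolynomial.eval u (q i)) =
        ∑ w ∈ T, c w • diagonal (cyclicWeight (fun a j => u (a, j)) w) := by
      ext i j
      by_cases hij : i = j
      · subst hij; simp [hq, Matrix.sum_apply]
      · simp [hij, Matrix.sum_apply]
    rw [hdiag, Finset.sum_mul]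
    refine Finset.sum_congr rfl fun w hw => ?_
    rw [prod_map_diagonal_mul_shift (fun a i => u (a, i)) w, hlen w hw, smul_mul_assoc]
  rw [hsum, det_mul, det_diagonal, det_pow, det_permutation, ← map_prod]
  refine mul_ne_zero hu (pow_ne_zero _ ?_)
  rcases Int.units_eq_one_or (Equiv.Perm.sign (Equiv.addRight (1 : Fin (d + 1)))) with h | h <;>
    simp [h]

/-- If `f ∈ k⟨x,y⟩` has constant term `1` and `det f(X,Y)` is independent of `Y` at all matrix
tuples, then `f` is a noncommutative polynomial in `x` only. -/
theorem mem_xSubalgebra_of_det_independent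
    {k : Type*} [Field k] [IsAlgClosed k] [CharZero k] {g h : ℕ}
    (f : FreeAlgebra k (Fin g ⊕ Fin h))
    (h0 : FreeAlgebra.lift k (fun _ : Fin g ⊕ Fin h => (0 : k)) f = 1)
    (hindep : ∀ (n : ℕ) (X : Fin g → Matrix (Fin n) (Fin n) k)
        (Y Y' : Fin h → Matrix (Fin n) (Fin n) k),
        (FreeAlgebra.lift k (Sum.elim X Y) f).det =
          (FreeAlgebra.lift k (Sum.elim X Y') f).det) :
    f ∈ (FreeAlgebra.lift k
        (fun j : Fin g => FreeAlgebra.ι k (Sum.inl j : Fin g ⊕ Fin h)) :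
      FreeAlgebra k (Fin g) →ₐ[k] FreeAlgebra k (Fin g ⊕ Fin h)).range := by
  obtain ⟨c, rfl⟩ := FreeAlgebra.exists_finsupp_word f
  simp only [FreeAlgebra.lift_finsupp_word] at hindep
  by_cases hx : ∀ w ∈ c.support, ∀ a ∈ w, a.isLeft
  · refine Subalgebra.sum_mem _ fun w hw => Subalgebra.smul_mem _ (Subalgebra.list_prod_mem _ ?_) _
    intro z hz
    obtain ⟨a, ha, rfl⟩ := List.mem_map.mp hz
    obtain ⟨j, rfl⟩ := Sum.isLeft_iff.mp (hx w hw a ha)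
    exact ⟨FreeAlgebra.ι k j, by simp⟩
  · exfalso
    push Not at hx
    obtain ⟨w₁, hw₁, a₁, ha₁, hr₁⟩ := hx
    let N := c.support.sup List.length + 1
    let wt : Fin g ⊕ Fin h → ℕ := Sum.elim (fun _ => 1) (fun _ => N)
    have hN (w) (hw : w ∈ c.support) : w.length < N :=
      Nat.lt_succ_of_le (Finset.le_sup (f := List.length) hw)
    obtain ⟨w₀, hw₀, hmax⟩ := Finset.exists_max_image c.support
      (fun w => (w.map wt).sum) ⟨w₁, hw₁⟩
    have hwt (w : List (Fin g ⊕ Fin h)) :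
        (w.map wt).sum + w.countP Sum.isRight = w.length + N * w.countP Sum.isRight := by
      induction w with
      | nil => simp
      | cons a w ih =>
        rcases a with a | a <;> simp [wt, List.countP_cons] at ih ⊢ <;> linarith
    have hNW : N ≤ (w₀.map wt).sum := by
      refine le_trans ?_ (hmax w₁ hw₁)
      refine List.single_le_sum (by simp) _ (List.mem_map.mpr ⟨a₁, ha₁, ?_⟩)
      rcases a₁ with a | a
      · simp at hr₁
      · rfl
    let T := c.support.filter fun w => (w.map wt).sum = (w₀.map wt).sum
    have hlen (w) (hw : w ∈ T) : w.length = w₀.length := by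
      obtain ⟨hw, hww⟩ := Finset.mem_filter.mp hw
      have h1 := hwt w
      have h2 := hwt w₀
      have h3 := hN w hw
      have h4 := hN w₀ hw₀
      have h5 : w.countP Sum.isRight ≤ w.length := List.countP_le_length
      have h6 : w₀.countP Sum.isRight ≤ w₀.length := List.countP_le_length
      have hcount : w.countP Sum.isRight = w₀.countP Sum.isRight := by
        rcases lt_trichotomy (w.countP Sum.isRight) (w₀.countP Sum.isRight) with hlt | heq | hlt
        · nlinarith
        · exact heq
        · nlinarith
      rw [hcount] at h1
      omega
    obtain ⟨Z, hZ⟩ := exists_det_sum_words_ne_zero T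
      ⟨w₀, by simp [T, Finsupp.mem_support_iff.mp hw₀]⟩ hlen c
      (fun w hw => Finsupp.mem_support_iff.mp (Finset.mem_filter.mp hw).1)
    apply hZ
    have hrescale (Y : Fin h → Matrix (Fin (w₀.length + 1)) (Fin (w₀.length + 1)) k) (s : k) :
        (fun i => s ^ wt i • Sum.elim (fun j => Z (Sum.inl j)) Y i) =
          Sum.elim (fun j => s • Z (Sum.inl j)) (fun j => s ^ N • Y j) := by
      funext i
      rcases i with i | i <;> simp [wt]
    have htop := det_topWeight_eq c wt _ hmax
      (Sum.elim (fun j => Z (Sum.inl j)) (fun j => Z (Sum.inr j)))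
      (Sum.elim (fun j => Z (Sum.inl j)) 0) fun s => by
        rw [hrescale, hrescale]
        exact hindep _ _ _ _
    rw [show Sum.elim (fun j => Z (Sum.inl j)) (fun j => Z (Sum.inr j)) = Z from
      Sum.elim_comp_inl_inr Z] at htop
    rw [htop, Finset.sum_eq_zero, det_zero]
    intro w hw
    obtain ⟨hw, hww⟩ := Finset.mem_filter.mp hw
    have hright : ∃ a ∈ w, a.isRight := by
      by_contra! hno
      have h0 : w.countP Sum.isRight = 0 := List.countP_eq_zero.mpr fun a ha => by
        simpa using hno a ha
      have h1 := hwt w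
      have h2 := hN w hw
      rw [h0] at h1
      omega
    obtain ⟨a, ha, hr⟩ := hright
    obtain ⟨j, rfl⟩ := Sum.isRight_iff.mp hr
    rw [List.prod_eq_zero (List.mem_map.mpr ⟨_, ha, by simp⟩), smul_zero]
end
end

section
/- Let k be an algebraically closed field of characteristic zero and let f ∈ k⟨x₁,…,x_g, y₁,…,y_h⟩ have nonzero constant term. Suppose there exists n₀ ∈ ℕ such that for every n ≥ n₀ the polynomial det f(gX^(n), gY^(n)) has a nonconstant factor involving only the ξ-variables, i.e. there is a nonconstant q in the subring of polynomials in the variables ξ_{j,ι,κ} (j ∈ Fin g) only, with q dividing det f(gX^(n), gY^(n)). Then f has a factor in k⟨x₁,…,x_g⟩: there exist u, v ∈ k⟨x,y⟩ and a nonconstant p in the image of the canonical embedding k⟨x₁,…,x_g⟩ → k⟨x,y⟩ such that f = u·p·v. -/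
open Matrix MvPolynomial

noncomputable section

/-- The generic matrix tuple for the free algebra on `Fin g ⊕ Fin h`: `gX⁽ⁿ⁾` together with
`gY⁽ⁿ⁾`. -/
def genZ (k : Type*) [CommRing k] (g h n : ℕ) :
    (Fin g ⊕ Fin h) →
      Matrix (Fin n) (Fin n) (MvPolynomial ((Fin g ⊕ Fin h) × Fin n × Fin n) k) :=
  fun j => Matrix.of fun ι κ => MvPolynomial.X (j, ι, κ)

namespace NCFactor

universe w

section FreeAlgebra

variable {k : Type*} [Field k] {Z : Type*}

/-- The constant term of a noncommutative polynomial. -/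
def constTerm : FreeAlgebra k Z →ₐ[k] k := FreeAlgebra.lift k (fun _ => (0 : k))

lemma constTerm_ι (z : Z) : constTerm (FreeAlgebra.ι k z) = 0 := by
  simp [constTerm]

open Classical in
/-- The triangular representation `a ↦ [[ε a, ∂ a], [0, a]]` defining the transduction `∂`. -/
def triRep (z : Z) : FreeAlgebra k Z →ₐ[k] Matrix (Fin 2) (Fin 2) (FreeAlgebra k Z) :=
  FreeAlgebra.lift k (fun z' => !![0, if z' = z then 1 else 0; 0, FreeAlgebra.ι k z'])

/-- The left transduction by the letter `z`: it removes an initial letter `z` from words, and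
kills words not starting with `z`. -/
def trans (z : Z) : FreeAlgebra k Z →ₗ[k] FreeAlgebra k Z where
  toFun a := triRep z a 0 1
  map_add' := by simp
  map_smul' := by simp

lemma triRep_apply (z : Z) (a : FreeAlgebra k Z) :
    triRep z a = !![algebraMap k _ (constTerm a), trans z a; 0, a] := by
  induction a using FreeAlgebra.induction with
  | grade0 r =>
    have h : triRep z (algebraMap k (FreeAlgebra k Z) r) = algebraMap k _ r :=
      AlgHom.commutes _ _
    ext i j
    fin_cases i <;> fin_cases j <;> simp [trans, h, Matrix.algebraMap_matrix_apply]
  | grade1 x =>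
    ext i j
    fin_cases i <;> fin_cases j <;> simp [trans, triRep, constTerm_ι]
  | mul a b ha hb =>
    have key : trans z (a * b) = (triRep z a * triRep z b) 0 1 := by
      change triRep z (a * b) 0 1 = _
      rw [map_mul]
    rw [key, map_mul, ha, hb]
    ext i j
    fin_cases i <;> fin_cases j <;> simp [Matrix.mul_apply, Fin.sum_univ_two]
  | add a b ha hb =>
    rw [map_add, ha, hb]
    ext i j
    fin_cases i <;> fin_cases j <;> simp

lemma trans_mul (z : Z) (a b : FreeAlgebra k Z) :
    trans z (a * b) = trans z a * b + constTerm a • trans z b := by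
  have h := congr_fun (congr_fun (map_mul (triRep z) a b) 0) 1
  rw [triRep_apply, triRep_apply, triRep_apply] at h
  simp [Matrix.mul_apply, Fin.sum_univ_two] at h
  rw [h, Algebra.smul_def, add_comm]

@[simp] lemma trans_algebraMap (z : Z) (c : k) :
    trans z (algebraMap k (FreeAlgebra k Z) c) = 0 := by
  have h : triRep z (algebraMap k (FreeAlgebra k Z) c) = algebraMap k _ c :=
    AlgHom.commutes _ _
  simp [trans, h, Matrix.algebraMap_matrix_apply]

@[simp] lemma trans_one (z : Z) : trans z (1 : FreeAlgebra k Z) = 0 := by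
  simpa using trans_algebraMap z (1 : k)

open Classical in
lemma trans_ι (z z' : Z) :
    trans z (FreeAlgebra.ι k z') = if z' = z then 1 else 0 := by
  simp [trans, triRep]

open Classical in
lemma trans_ι_mul (z z' : Z) (a : FreeAlgebra k Z) :
    trans z (FreeAlgebra.ι k z' * a) = if z' = z then a else 0 := by
  rw [trans_mul, trans_ι, constTerm_ι]
  split_ifs <;> simp

lemma eq_constTerm_add_sum [Fintype Z] (a : FreeAlgebra k Z) :
    a = algebraMap k _ (constTerm a) + ∑ z, FreeAlgebra.ι k z * trans z a := by
  classical
  induction a using FreeAlgebra.induction with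
  | grade0 r => simp
  | grade1 x => simp [constTerm_ι, trans_ι]
  | mul a b ha hb =>
    conv_lhs => rw [ha]
    simp_rw [trans_mul, mul_add, Finset.sum_add_distrib, add_mul, Finset.sum_mul]
    conv_lhs => enter [1]; rw [hb]
    simp only [mul_add, Finset.mul_sum, map_mul, mul_assoc, Algebra.smul_def]
    rw [add_assoc, add_comm (∑ z, FreeAlgebra.ι k z * (trans z a * b))]
    congr 2
    refine Finset.sum_congr rfl fun z _ => ?_
    rw [← mul_assoc, Algebra.commutes, mul_assoc]
  | add a b ha hb =>
    conv_lhs => rw [ha, hb]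
    simp only [map_add, mul_add, Finset.sum_add_distrib]
    abel

/-- Iterated left transduction along a word. -/
def transWord : List Z → FreeAlgebra k Z →ₗ[k] FreeAlgebra k Z
  | [] => LinearMap.id
  | z :: w => transWord w ∘ₗ trans z

@[simp] lemma transWord_nil (a : FreeAlgebra k Z) : transWord [] a = a := rfl

@[simp] lemma transWord_cons (z : Z) (w : List Z) (a : FreeAlgebra k Z) :
    transWord (z :: w) a = transWord w (trans z a) := rfl

/-- The subspace of noncommutative polynomials of degree less than `n`. -/
def degLT : ℕ → Submodule k (FreeAlgebra k Z)
  | 0 => ⊥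
  | n + 1 => ⨅ z, (degLT n).comap (trans z)

@[simp] lemma mem_degLT_zero {a : FreeAlgebra k Z} : a ∈ degLT 0 ↔ a = 0 := Iff.rfl

lemma mem_degLT_succ {n : ℕ} {a : FreeAlgebra k Z} :
    a ∈ degLT (n + 1) ↔ ∀ z, trans z a ∈ degLT n := by
  simp [degLT]

lemma degLT_le_succ (n : ℕ) : (degLT n : Submodule k (FreeAlgebra k Z)) ≤ degLT (n + 1) := by
  induction n with
  | zero => intro a ha; simp_all
  | succ n ih =>
    intro a ha
    rw [mem_degLT_succ] at ha ⊢
    exact fun z => ih (ha z)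

lemma degLT_mono {m n : ℕ} (h : m ≤ n) :
    (degLT m : Submodule k (FreeAlgebra k Z)) ≤ degLT n :=
  monotone_nat_of_le_succ degLT_le_succ h

lemma algebraMap_mem_degLT (n : ℕ) (c : k) :
    algebraMap k (FreeAlgebra k Z) c ∈ degLT (n + 1) := by
  rw [mem_degLT_succ]; simp

lemma eq_algebraMap_of_mem_degLT_one [Fintype Z] {a : FreeAlgebra k Z} (ha : a ∈ degLT 1) :
    a = algebraMap k _ (constTerm a) := by
  rw [mem_degLT_succ] at ha
  simp only [mem_degLT_zero] at ha
  conv_lhs => rw [eq_constTerm_add_sum a]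
  simp [ha]

lemma mul_mem_degLT {p q : ℕ} {a b : FreeAlgebra k Z} (ha : a ∈ degLT (p + 1))
    (hb : b ∈ degLT q) : a * b ∈ degLT (p + q) := by
  cases q with
  | zero => simp_all
  | succ q =>
    induction p generalizing a with
    | zero =>
      rw [zero_add, mem_degLT_succ]
      intro z
      rw [trans_mul]
      have h1 : trans z a = 0 := by simpa using (mem_degLT_succ.1 ha) z
      rw [h1, zero_mul, zero_add]
      exact Submodule.smul_mem _ _ (mem_degLT_succ.1 hb z)
    | succ p ih =>
      rw [show p + 1 + (q + 1) = (p + (q + 1)) + 1 by ring, mem_degLT_succ]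
      intro z
      rw [trans_mul]
      refine Submodule.add_mem _ (ih (mem_degLT_succ.1 ha z)) (Submodule.smul_mem _ _ ?_)
      exact degLT_mono (by omega) (mem_degLT_succ.1 hb z)

lemma exists_mem_degLT (a : FreeAlgebra k Z) : ∃ n, a ∈ degLT n := by
  induction a using FreeAlgebra.induction with
  | grade0 r => exact ⟨1, algebraMap_mem_degLT 0 r⟩
  | grade1 x =>
    refine ⟨2, mem_degLT_succ.2 fun z => ?_⟩
    classical
    rw [trans_ι]
    split_ifs
    · simpa using algebraMap_mem_degLT 0 (1 : k)
    · exact Submodule.zero_mem _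
  | mul a b ha hb =>
    obtain ⟨p, hp⟩ := ha
    obtain ⟨q, hq⟩ := hb
    exact ⟨p + q, mul_mem_degLT (degLT_le_succ _ hp) hq⟩
  | add a b ha hb =>
    obtain ⟨p, hp⟩ := ha
    obtain ⟨q, hq⟩ := hb
    exact ⟨max p q, Submodule.add_mem _ (degLT_mono (le_max_left _ _) hp)
      (degLT_mono (le_max_right _ _) hq)⟩

open Classical in
/-- One more than the degree of a noncommutative polynomial (and `0` for the zero polynomial). -/
def len (a : FreeAlgebra k Z) : ℕ := Nat.find (exists_mem_degLT a)

lemma len_le_iff {a : FreeAlgebra k Z} {n : ℕ} : len a ≤ n ↔ a ∈ degLT n := by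
  classical
  constructor
  · intro h
    exact degLT_mono h (Nat.find_spec (exists_mem_degLT a))
  · intro h
    exact Nat.find_min' _ h

lemma mem_degLT_len (a : FreeAlgebra k Z) : a ∈ degLT (len a) := len_le_iff.1 le_rfl

lemma len_eq_zero_iff {a : FreeAlgebra k Z} : len a = 0 ↔ a = 0 := by
  rw [← Nat.le_zero, len_le_iff, mem_degLT_zero]

lemma transWord_mem_degLT {n : ℕ} {w : List Z} {a : FreeAlgebra k Z}
    (ha : a ∈ degLT (n + w.length)) : transWord w a ∈ degLT n := by
  induction w generalizing a with
  | nil => simpa using ha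
  | cons z w ih =>
    refine ih ?_
    rw [List.length_cons, ← add_assoc] at ha
    exact mem_degLT_succ.1 ha z

lemma exists_transWord_ne_zero {n : ℕ} {a : FreeAlgebra k Z} (ha : a ∉ degLT n) :
    ∃ w : List Z, w.length = n ∧ transWord w a ≠ 0 := by
  induction n generalizing a with
  | zero => exact ⟨[], rfl, by simpa using ha⟩
  | succ n ih =>
    rw [mem_degLT_succ] at ha
    push Not at ha
    obtain ⟨z, hz⟩ := ha
    obtain ⟨w, hw, h⟩ := ih hz
    exact ⟨z :: w, by simp [hw], h⟩

/-- A nonzero polynomial of degree `n` becomes a nonzero constant after transduction along a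
suitable word of length `n`. -/
lemma exists_transWord_eq_algebraMap [Fintype Z] {a : FreeAlgebra k Z} {n : ℕ}
    (ha : len a = n + 1) :
    ∃ w : List Z, w.length = n ∧ ∃ c : k, c ≠ 0 ∧ transWord w a = algebraMap k _ c := by
  have h : a ∉ degLT n := fun h => by have := len_le_iff.2 h; omega
  obtain ⟨w, hw, hne⟩ := exists_transWord_ne_zero h
  have h1 : transWord w a ∈ degLT 1 := by
    apply transWord_mem_degLT
    rw [hw, add_comm, ← ha]
    exact mem_degLT_len a
  refine ⟨w, hw, _, ?_, eq_algebraMap_of_mem_degLT_one h1⟩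
  intro h0
  rw [eq_algebraMap_of_mem_degLT_one h1, h0, map_zero] at hne
  exact hne rfl

lemma transWord_mul_sub_mem {q : ℕ} (w : List Z) (a : FreeAlgebra k Z) {b : FreeAlgebra k Z}
    (hb : b ∈ degLT (q + 1)) : transWord w (a * b) - transWord w a * b ∈ degLT q := by
  induction w generalizing a with
  | nil => simp
  | cons z w ih =>
    rw [transWord_cons, transWord_cons, trans_mul, map_add, add_sub_right_comm]
    refine Submodule.add_mem _ (ih _) ?_
    rw [map_smul]
    refine Submodule.smul_mem _ _ (transWord_mem_degLT ?_)
    exact degLT_mono (by omega) (mem_degLT_succ.1 hb z)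

lemma len_mul [Fintype Z] {a b : FreeAlgebra k Z} (ha : a ≠ 0) (hb : b ≠ 0) :
    len (a * b) + 1 = len a + len b := by
  obtain ⟨p, hp⟩ := Nat.exists_eq_succ_of_ne_zero (mt len_eq_zero_iff.1 ha)
  obtain ⟨q, hq⟩ := Nat.exists_eq_succ_of_ne_zero (mt len_eq_zero_iff.1 hb)
  have h1 : len (a * b) ≤ p + (q + 1) :=
    len_le_iff.2 (mul_mem_degLT (len_le_iff.1 hp.le) (len_le_iff.1 hq.le))
  have h2 : ¬ len (a * b) ≤ p + q := by
    intro h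
    rw [len_le_iff] at h
    obtain ⟨w, hw, c, hc, hwa⟩ := exists_transWord_eq_algebraMap hp
    have h3 := transWord_mul_sub_mem w a (q := q) (len_le_iff.1 hq.le)
    have h4 : transWord w (a * b) ∈ degLT q := transWord_mem_degLT (by rwa [hw, add_comm])
    have h5 := Submodule.sub_mem _ h4 h3
    rw [sub_sub_cancel, hwa, ← Algebra.smul_def, Submodule.smul_mem_iff _ hc, ← len_le_iff] at h5
    omega
  omega

instance finiteDimensional_degLT [Finite Z] (n : ℕ) :
    FiniteDimensional k (degLT n : Submodule k (FreeAlgebra k Z)) := by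
  have := Fintype.ofFinite Z
  induction n with
  | zero => change FiniteDimensional k (⊥ : Submodule k (FreeAlgebra k Z)); infer_instance
  | succ n ih =>
    have hle : (degLT (n + 1) : Submodule k (FreeAlgebra k Z)) ≤
        (k ∙ (1 : FreeAlgebra k Z)) ⊔
          ⨆ z, (degLT n).map (LinearMap.mulLeft k (FreeAlgebra.ι k z)) := by
      intro a ha
      rw [eq_constTerm_add_sum a]
      refine Submodule.add_mem_sup ?_ ?_
      · exact Submodule.mem_span_singleton.2 ⟨constTerm a, by simp [Algebra.algebraMap_eq_smul_one]⟩
      · refine Submodule.sum_mem _ fun z _ => ?_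
        exact Submodule.mem_iSup_of_mem z ⟨_, mem_degLT_succ.1 ha z, rfl⟩
    exact Submodule.finiteDimensional_of_le hle

/-- The weak algorithm: a left dependence relation lets one lower the degree of one of the
elements by subtracting a left combination of the others. -/
lemma exists_len_sub_lt [Fintype Z] {ι : Type*} [Fintype ι] (r b : ι → FreeAlgebra k Z)
    (h : ∑ i, r i * b i = 0) (hne : ∃ i, r i * b i ≠ 0) :
    ∃ i, ∃ c : ι → FreeAlgebra k Z, c i = 0 ∧ len (b i - ∑ j, c j * b j) < len (b i) := by
  classical
  obtain ⟨i₀, hi₀⟩ := hne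
  obtain ⟨i, hiS, hmax⟩ := Finset.exists_max_image (Finset.univ.filter fun i => r i * b i ≠ 0)
    (fun i => toLex (len (r i) + len (b i), len (b i))) ⟨i₀, by simpa using hi₀⟩
  simp only [Finset.mem_filter, Finset.mem_univ, true_and] at hiS hmax
  obtain ⟨ρ, hρ⟩ := Nat.exists_eq_succ_of_ne_zero (mt len_eq_zero_iff.1 (left_ne_zero_of_mul hiS))
  obtain ⟨β, hβ⟩ := Nat.exists_eq_succ_of_ne_zero (mt len_eq_zero_iff.1 (right_ne_zero_of_mul hiS))
  obtain ⟨w, hw, c, hc, hwc⟩ := exists_transWord_eq_algebraMap hρ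
  have key : ∀ j, ∃ d, (j = i → d = algebraMap k _ c) ∧
      transWord w (r j * b j) - d * b j ∈ degLT β := by
    intro j
    by_cases hj : r j * b j = 0
    · exact ⟨0, fun hji => absurd hj (hji ▸ hiS), by simp [hj]⟩
    have hm := hmax j hj
    rw [Prod.Lex.toLex_le_toLex] at hm
    rcases hm with hm | ⟨-, hm⟩
    · refine ⟨0, fun hji => by subst hji; simp at hm, ?_⟩
      rw [zero_mul, sub_zero]
      refine transWord_mem_degLT (len_le_iff.1 ?_)
      have := len_mul (left_ne_zero_of_mul hj) (right_ne_zero_of_mul hj)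
      simp only at hm
      omega
    · refine ⟨transWord w (r j), fun hji => hji ▸ hwc, transWord_mul_sub_mem w _ ?_⟩
      exact len_le_iff.1 (by simp only at hm; omega)
  choose d hd hdm using key
  have hsum : ∑ j, d j * b j ∈ degLT β := by
    have h1 := Submodule.sum_mem _ fun j (_ : j ∈ Finset.univ) => hdm j
    rw [Finset.sum_sub_distrib, ← map_sum, h, map_zero, zero_sub, Submodule.neg_mem_iff] at h1
    exact h1
  refine ⟨i, fun j => if j = i then 0 else -(c⁻¹ • d j), by simp, ?_⟩
  rw [hβ, Nat.lt_succ_iff, len_le_iff]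
  convert Submodule.smul_mem _ c⁻¹ hsum using 1
  rw [← Finset.add_sum_erase _ _ (Finset.mem_univ i),
    ← Finset.add_sum_erase _ (fun j => d j * b j) (Finset.mem_univ i), hd i rfl, smul_add,
    ← smul_mul_assoc, Algebra.smul_def, ← map_mul, inv_mul_cancel₀ hc, map_one, one_mul]
  simp only [if_true]
  rw [
    zero_mul, zero_add, sub_eq_add_neg, Finset.smul_sum, ← Finset.sum_neg_distrib]
  congr 1
  refine Finset.sum_congr rfl fun j hj => ?_
  rw [if_neg (Finset.ne_of_mem_erase hj)]
  simp

/-- A tuple of `s + 1` elements satisfying `s` left relations whose constant terms are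
independent generates a principal left ideal. -/
lemma exists_generator_of_relations [Fintype Z] {ι τ : Type*} [Fintype ι] [Fintype τ]
    (hcard : Fintype.card ι ≤ Fintype.card τ + 1) (a : ι → FreeAlgebra k Z) (ha : a ≠ 0)
    (Q : τ → ι → FreeAlgebra k Z) (hQ : ∀ t, ∑ i, Q t i * a i = 0)
    (hind : ∀ c : τ → k, (∀ i, ∑ t, c t * constTerm (Q t i) = 0) → c = 0) :
    ∃ f, (∀ i, ∃ p, a i = p * f) ∧ ∃ l : ι → FreeAlgebra k Z, f = ∑ i, l i * a i := by
  classical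
  induction hn : ∑ i, len (a i) using Nat.strong_induction_on generalizing a Q with
  | _ n ih =>
  by_cases hdep : ∃ t i, Q t i * a i ≠ 0
  · obtain ⟨t, ht⟩ := hdep
    obtain ⟨i, c, hci, hlt⟩ := exists_len_sub_lt (Q t) a (hQ t) ht
    set a' := Function.update a i (a i - ∑ j, c j * a j) with ha'
    have hsub : ∀ r : FreeAlgebra k Z, ∀ j, r * a' j = r * a j -
        (if j = i then r * ∑ j, c j * a j else 0) := by
      intro r j
      by_cases hj : j = i
      · subst hj; simp [ha', mul_sub]
      · simp [ha', hj]
    have hcs : ∑ j, c j * a' j = ∑ j, c j * a j := by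
      refine Finset.sum_congr rfl fun j _ => ?_
      rw [hsub]
      split_ifs with hj
      · rw [hj, hci, zero_mul, zero_mul, sub_zero]
      · rw [sub_zero]
    have hback : a i = a' i + ∑ j, c j * a' j := by rw [hcs]; simp [ha']
    have ha'0 : a' ≠ 0 := by
      intro h0
      apply ha
      funext j
      by_cases hj : j = i
      · rw [hj, hback, h0]; simp
      · have := congr_fun h0 j
        simpa [ha', hj] using this
    obtain ⟨f, hf1, l, hf2⟩ := ih (∑ i, len (a' i)) (by
        rw [← hn]
        refine Finset.sum_lt_sum (fun j _ => ?_) ⟨i, Finset.mem_univ _, ?_⟩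
        · by_cases hj : j = i
          · subst hj; simpa [ha'] using hlt.le
          · simp [ha', hj]
        · simpa [ha'] using hlt)
      a' ha'0 (fun t j => Q t j + Q t i * c j)
      (fun t => by
        simp_rw [add_mul, Finset.sum_add_distrib, mul_assoc, ← Finset.mul_sum, hcs, hsub,
          Finset.sum_sub_distrib, hQ]
        simp)
      (fun e he => by
        have hi : ∑ t, e t * constTerm (Q t i) = 0 := by simpa [hci] using he i
        refine hind e fun j => ?_
        have hj := he j
        simp_rw [map_add, map_mul, mul_add, Finset.sum_add_distrib, ← mul_assoc,
          ← Finset.sum_mul, hi] at hj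
        simpa using hj) rfl
    refine ⟨f, fun j => ?_, fun j => l j - l i * c j, ?_⟩
    · by_cases hj : j = i
      · choose p hp using hf1
        refine ⟨p i + ∑ j, c j * p j, ?_⟩
        rw [hj, hback, add_mul, Finset.sum_mul, ← hp]
        simp_rw [mul_assoc, ← hp]
      · simpa [ha', hj] using hf1 j
    · rw [hf2]
      simp_rw [hsub, sub_mul, Finset.sum_sub_distrib, mul_assoc, ← Finset.mul_sum]
      simp
  · push Not at hdep
    obtain ⟨i, hi⟩ := Function.ne_iff.1 ha
    have huniq : ∀ j, j ≠ i → a j = 0 := by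
      intro j hji
      by_contra hj
      have h0 : ∀ l, a l ≠ 0 → ∀ t, Q t l = 0 := fun l hl t =>
        (mul_eq_zero.1 (hdep t l)).resolve_right hl
      let s : Finset ι := (Finset.univ.erase i).erase j
      have hs : s.card + 2 = Fintype.card ι := by
        have h1 := Finset.card_erase_add_one (Finset.mem_univ i)
        have h2 := Finset.card_erase_add_one
          (Finset.mem_erase.2 ⟨hji, Finset.mem_univ j⟩ : j ∈ Finset.univ.erase i)
        rw [Finset.card_univ] at h1
        change ((Finset.univ.erase i).erase j).card + 2 = _
        omega
      let L : (τ → k) →ₗ[k] (s → k) :=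
        { toFun := fun c l => ∑ t, c t * constTerm (Q t l)
          map_add' := fun c c' => by funext l; simp [add_mul, Finset.sum_add_distrib]
          map_smul' := fun x c => by funext l; simp [Finset.mul_sum, mul_assoc] }
      have hL : Function.Injective L := by
        rw [← LinearMap.ker_eq_bot, LinearMap.ker_eq_bot']
        intro c hc
        refine hind c fun l => ?_
        by_cases hl : l ∈ s
        · exact congr_fun hc ⟨l, hl⟩
        · have : l = j ∨ l = i := by
            by_contra hcon
            push Not at hcon
            exact hl (by simp [s, hcon.1, hcon.2])
          rcases this with rfl | rfl
          · simp [h0 l hj]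
          · simp [h0 l hi]
      have := LinearMap.finrank_le_finrank_of_injective hL
      simp only [Module.finrank_fintype_fun_eq_card, Fintype.card_coe] at this
      omega
    refine ⟨a i, fun j => ?_, fun j => if j = i then 1 else 0, by simp⟩
    by_cases hj : j = i
    · exact ⟨1, by simp [hj]⟩
    · exact ⟨0, by simp [huniq j hj]⟩

/-- Composition of a family of endomorphisms along a word; the first letter acts first. -/
def opWord {V : Type*} [AddCommGroup V] [Module k V] (C : Z → Module.End k V) :
    List Z → Module.End k V
  | [] => 1
  | z :: w => opWord C w * C z

lemma opWord_append {V : Type*} [AddCommGroup V] [Module k V] (C : Z → Module.End k V)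
    (u w : List Z) : opWord C (u ++ w) = opWord C w * opWord C u := by
  induction u with
  | nil => simp [opWord]
  | cons z u ih => simp [opWord, ih, mul_assoc]

/-- Burnside's theorem on matrix algebras. -/
lemma adjoin_eq_top_of_irreducible [IsAlgClosed k] {V : Type*} [AddCommGroup V] [Module k V]
    [FiniteDimensional k V] [Nontrivial V] (C : Z → Module.End k V)
    (hirr : ∀ U : Submodule k V, (∀ z, ∀ u ∈ U, C z u ∈ U) → U = ⊥ ∨ U = ⊤) :
    Algebra.adjoin k (Set.range C) = ⊤ := by
  set A := Algebra.adjoin k (Set.range C) with hA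
  have hsimple : IsSimpleModule A V := by
    refine { eq_bot_or_eq_top := fun U => ?_ }
    rcases hirr (U.restrictScalars k) (fun z u hu =>
      U.smul_mem ⟨C z, Algebra.subset_adjoin ⟨z, rfl⟩⟩ hu) with h | h
    · left
      exact (Submodule.restrictScalars_eq_bot_iff _ _ _).1 h
    · right
      exact (Submodule.restrictScalars_eq_top_iff _ _ _).1 h
  rw [eq_top_iff]
  intro T _
  let f : Module.End (Module.End A V) V :=
    { toFun := T
      map_add' := map_add T
      map_smul' := fun c v => by
        obtain ⟨t, rfl⟩ := (IsSimpleModule.algebraMap_end_bijective_of_isAlgClosed k).2 c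
        simp }
  classical
  let b := Module.finBasis k V
  obtain ⟨r, hr⟩ := jacobson_density f (Finset.univ.image b)
  have : T = r.1 := b.ext fun i => hr (b i) (by simp)
  rw [this]
  exact r.2

lemma span_opWord_eq_top [IsAlgClosed k] {V : Type*} [AddCommGroup V] [Module k V]
    [FiniteDimensional k V] (C : Z → Module.End k V)
    (hirr : ∀ U : Submodule k V, (∀ z, ∀ u ∈ U, C z u ∈ U) → U = ⊥ ∨ U = ⊤)
    (P : Z → Prop) (hP : ∃ z, P z ∧ C z ≠ 0) :
    Submodule.span k {T | ∃ w : List Z, (∃ z ∈ w, P z) ∧ opWord C w = T} = ⊤ := by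
  obtain ⟨z₀, hz₀, hne⟩ := hP
  obtain ⟨v₀, hv₀⟩ : ∃ v, C z₀ v ≠ 0 := by
    by_contra! h
    exact hne (LinearMap.ext h)
  have : Nontrivial V := ⟨⟨_, _, hv₀⟩⟩
  have htop := adjoin_eq_top_of_irreducible C hirr
  set I := Submodule.span k {T | ∃ w : List Z, (∃ z ∈ w, P z) ∧ opWord C w = T} with hI
  have hl : ∀ A : Module.End k V, ∀ T ∈ I, A * T ∈ I := by
    intro A
    have hA : A ∈ Algebra.adjoin k (Set.range C) := htop ▸ Algebra.mem_top
    induction hA using Algebra.adjoin_induction with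
    | mem A hA =>
      obtain ⟨z, rfl⟩ := hA
      intro T hT
      induction hT using Submodule.span_induction with
      | mem T hT =>
        obtain ⟨w, ⟨z', hz', hPz'⟩, rfl⟩ := hT
        exact Submodule.subset_span ⟨w ++ [z], ⟨z', by simp [hz'], hPz'⟩, by
          simp [opWord_append, opWord]⟩
      | zero => simp
      | add S T _ _ hS hT => rw [mul_add]; exact I.add_mem hS hT
      | smul c T _ hT => rw [mul_smul_comm]; exact I.smul_mem _ hT
    | algebraMap r => intro T hT; rw [← Algebra.smul_def]; exact I.smul_mem _ hT
    | add A B _ _ hA hB => intro T hT; rw [add_mul]; exact I.add_mem (hA T hT) (hB T hT)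
    | mul A B _ _ hA hB => intro T hT; rw [mul_assoc]; exact hA _ (hB T hT)
  have hr : ∀ A : Module.End k V, ∀ T ∈ I, T * A ∈ I := by
    intro A
    have hA : A ∈ Algebra.adjoin k (Set.range C) := htop ▸ Algebra.mem_top
    induction hA using Algebra.adjoin_induction with
    | mem A hA =>
      obtain ⟨z, rfl⟩ := hA
      intro T hT
      induction hT using Submodule.span_induction with
      | mem T hT =>
        obtain ⟨w, ⟨z', hz', hPz'⟩, rfl⟩ := hT
        exact Submodule.subset_span ⟨z :: w, ⟨z', by simp [hz'], hPz'⟩, rfl⟩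
      | zero => simp
      | add S T _ _ hS hT => rw [add_mul]; exact I.add_mem hS hT
      | smul c T _ hT => rw [smul_mul_assoc]; exact I.smul_mem _ hT
    | algebraMap r =>
      intro T hT; rw [← Algebra.commutes, ← Algebra.smul_def]; exact I.smul_mem _ hT
    | add A B _ _ hA hB => intro T hT; rw [mul_add]; exact I.add_mem (hA T hT) (hB T hT)
    | mul A B _ _ hA hB => intro T hT; rw [← mul_assoc]; exact hB _ (hA T hT)
  have h0 : C z₀ ∈ I := Submodule.subset_span ⟨[z₀], ⟨z₀, by simp, hz₀⟩, by simp [opWord]⟩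
  obtain ⟨l, hl1⟩ := Module.Projective.exists_dual_eq_one k hv₀
  rw [eq_top_iff]
  intro T _
  let b := Module.finBasis k V
  have hT : T = ∑ i, (l.smulRight (T (b i))) * (C z₀ * (b.coord i).smulRight v₀) := by
    refine b.ext fun j => ?_
    rw [LinearMap.sum_apply, Finset.sum_eq_single j]
    · simp [hl1]
    · intro i _ hij
      simp [Finsupp.single_eq_of_ne hij]
    · simp
  rw [hT]
  exact Submodule.sum_mem _ fun i _ => hl _ _ (hr _ _ h0)

/-- Transduction followed by the projection along `f` onto polynomials without constant term. -/
def stateOp (f : FreeAlgebra k Z) (z : Z) : Module.End k (FreeAlgebra k Z) :=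
  trans z - (constTerm.toLinearMap ∘ₗ trans z).smulRight f

lemma stateOp_apply (f : FreeAlgebra k Z) (z : Z) (a : FreeAlgebra k Z) :
    stateOp f z a = trans z a - constTerm (trans z a) • f := rfl

lemma constTerm_stateOp {f : FreeAlgebra k Z} (hf : constTerm f = 1) (z : Z)
    (a : FreeAlgebra k Z) : constTerm (stateOp f z a) = 0 := by
  simp [stateOp_apply, hf]

/-- The span of the orbit of `1 - f` under the operators `stateOp f z`. -/
def stateSpace (f : FreeAlgebra k Z) : Submodule k (FreeAlgebra k Z) :=
  Submodule.span k (Set.range fun w => opWord (stateOp f) w (1 - f))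

lemma one_sub_mem_stateSpace (f : FreeAlgebra k Z) : 1 - f ∈ stateSpace f :=
  Submodule.subset_span ⟨[], rfl⟩

lemma opWord_concat_apply {V : Type*} [AddCommGroup V] [Module k V] (C : Z → Module.End k V)
    (w : List Z) (z : Z) (a : V) : opWord C (w ++ [z]) a = C z (opWord C w a) := by
  simp [opWord_append, opWord]

lemma stateSpace_le {f : FreeAlgebra k Z} {U : Submodule k (FreeAlgebra k Z)}
    (h1 : 1 - f ∈ U) (h : ∀ z, ∀ u ∈ U, stateOp f z u ∈ U) : stateSpace f ≤ U := by
  refine Submodule.span_le.2 ?_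
  rintro _ ⟨w, rfl⟩
  induction w using List.reverseRecOn with
  | nil => exact h1
  | append_singleton w z ih =>
    simp only [opWord_concat_apply]
    exact h z _ ih

lemma stateOp_mem_stateSpace {f : FreeAlgebra k Z} (z : Z) {a : FreeAlgebra k Z}
    (ha : a ∈ stateSpace f) : stateOp f z a ∈ stateSpace f := by
  induction ha using Submodule.span_induction with
  | mem a ha =>
    obtain ⟨w, rfl⟩ := ha
    exact Submodule.subset_span ⟨w ++ [z], opWord_concat_apply _ _ _ _⟩
  | zero => simp
  | add a b _ _ ha hb => rw [map_add]; exact Submodule.add_mem _ ha hb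
  | smul c a _ ha => rw [map_smul]; exact Submodule.smul_mem _ _ ha

lemma constTerm_of_mem_stateSpace {f : FreeAlgebra k Z} (hf : constTerm f = 1)
    {a : FreeAlgebra k Z} (ha : a ∈ stateSpace f) : constTerm a = 0 := by
  have : stateSpace f ≤ LinearMap.ker (constTerm (k := k) (Z := Z)).toLinearMap :=
    stateSpace_le (by simp [hf]) fun z u _ => by simpa using constTerm_stateOp hf z u
  simpa using this ha

lemma stateSpace_le_degLT {f : FreeAlgebra k Z} (hf : constTerm f = 1) :
    stateSpace f ≤ degLT (len f) := by
  have h0 : len f ≠ 0 := by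
    rw [Ne, len_eq_zero_iff]
    rintro rfl
    simp at hf
  obtain ⟨n, hn⟩ := Nat.exists_eq_succ_of_ne_zero h0
  refine stateSpace_le ?_ fun z u hu => ?_
  · refine Submodule.sub_mem _ ?_ (mem_degLT_len f)
    rw [hn]
    simpa using algebraMap_mem_degLT n (1 : k)
  · rw [stateOp_apply]
    refine Submodule.sub_mem _ ?_ (Submodule.smul_mem _ _ (mem_degLT_len f))
    rw [hn] at hu ⊢
    exact degLT_le_succ _ (mem_degLT_succ.1 hu z)

instance finiteDimensional_stateSpace [Finite Z] {f : FreeAlgebra k Z}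
    [hf : Fact (constTerm f = 1)] : FiniteDimensional k (stateSpace f) :=
  Submodule.finiteDimensional_of_le (stateSpace_le_degLT hf.out)

/-- An invariant subspace of the state space containing the images of all the operators is
everything. -/
lemma stateSpace_le_of_stateOp_mem [Fintype Z] {f : FreeAlgebra k Z} (hf : constTerm f = 1)
    (hconst : ∀ c, f ≠ algebraMap k _ c) {F : Submodule k (FreeAlgebra k Z)}
    (h : ∀ z, ∀ a ∈ stateSpace f, stateOp f z a ∈ F) : stateSpace f ≤ F := by
  wlog hF : F ≤ stateSpace f generalizing F
  · exact (this (F := F ⊓ stateSpace f)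
      (fun z a ha => ⟨h z a ha, stateOp_mem_stateSpace z ha⟩) inf_le_right).trans inf_le_left
  refine stateSpace_le ?_ fun z u hu => h z u (hF hu)
  have hstep : ∀ z, ∀ a ∈ stateSpace f, trans z a ∈ F ⊔ k ∙ f := by
    intro z a ha
    rw [← sub_add_cancel (trans z a) (constTerm (trans z a) • f)]
    exact Submodule.add_mem_sup (h z a ha) (Submodule.smul_mem _ _
      (Submodule.mem_span_singleton_self f))
  have hf1 : ∀ z, trans z f ∈ F ⊔ k ∙ f := by
    intro z
    have := hstep z _ (one_sub_mem_stateSpace f)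
    rw [map_sub, trans_one, zero_sub] at this
    exact (Submodule.neg_mem_iff _).1 this
  have hword : ∀ w : List Z, ∀ a ∈ F ⊔ k ∙ f, transWord w a ∈ F ⊔ k ∙ f := by
    intro w
    induction w with
    | nil => exact fun a ha => ha
    | cons z w ih =>
      intro a ha
      refine ih _ ?_
      obtain ⟨b, hb, c, hc, rfl⟩ := Submodule.mem_sup.1 ha
      obtain ⟨t, rfl⟩ := Submodule.mem_span_singleton.1 hc
      rw [map_add, map_smul]
      exact Submodule.add_mem _ (hstep z b (hF hb)) (Submodule.smul_mem _ _ (hf1 z))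
  have h0 : len f ≠ 0 := by
    rw [Ne, len_eq_zero_iff]
    rintro rfl
    simp at hf
  obtain ⟨n, hn⟩ := Nat.exists_eq_succ_of_ne_zero h0
  obtain ⟨w, hw, c, hc, hwc⟩ := exists_transWord_eq_algebraMap hn
  have hcm : algebraMap k (FreeAlgebra k Z) c ∈ F ⊔ k ∙ f :=
    hwc ▸ hword w f (Submodule.mem_sup_right (Submodule.mem_span_singleton_self f))
  obtain ⟨b, hb, d, hd, hbd⟩ := Submodule.mem_sup.1 hcm
  obtain ⟨t, rfl⟩ := Submodule.mem_span_singleton.1 hd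
  have ht : t = c := by
    have := congrArg constTerm hbd
    simpa [constTerm_of_mem_stateSpace hf (hF hb), hf] using this
  have hb' : b = c • (1 - f) := by
    rw [eq_sub_of_add_eq hbd, ht, smul_sub, Algebra.algebraMap_eq_smul_one]
  rwa [hb', Submodule.smul_mem_iff _ hc] at hb

lemma stateSpace_le_of_long_words [Fintype Z] {f : FreeAlgebra k Z} (hf : constTerm f = 1)
    (hconst : ∀ c, f ≠ algebraMap k _ c) {U : Submodule k (FreeAlgebra k Z)} (n : ℕ)
    (h : ∀ w : List Z, n ≤ w.length → opWord (stateOp f) w (1 - f) ∈ U) :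
    stateSpace f ≤ U := by
  induction n generalizing U with
  | zero =>
    refine Submodule.span_le.2 ?_
    rintro _ ⟨w, rfl⟩
    exact h w (Nat.zero_le _)
  | succ n ih =>
    refine stateSpace_le_of_stateOp_mem hf hconst fun z a ha => ?_
    have := ih (U := U.comap (stateOp f z)) (fun w hw => by
      rw [Submodule.mem_comap, ← opWord_concat_apply]
      exact h _ (by simpa using hw))
    exact this ha

lemma eq_sum_stateOp [Fintype Z] {f a : FreeAlgebra k Z} (ha : constTerm a = 0) :
    a = ∑ z, FreeAlgebra.ι k z * stateOp f z a +
      (∑ z, constTerm (trans z a) • FreeAlgebra.ι k z) * f := by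
  conv_lhs => rw [eq_constTerm_add_sum a, ha]
  simp [stateOp_apply, mul_sub, Finset.sum_sub_distrib, Finset.sum_mul]

lemma exists_tail_mem [Finite Z] {f : FreeAlgebra k Z}
    {U : Submodule k (FreeAlgebra k Z)}
    (r : FreeAlgebra k Z) {a : FreeAlgebra k Z}
    (ha : ∃ n, ∀ w : List Z, n ≤ w.length →
      opWord (stateOp f) w (a - constTerm a • f) ∈ U) :
    ∃ n, ∀ w : List Z, n ≤ w.length →
      opWord (stateOp f) w (r * a - constTerm (r * a) • f) ∈ U := by
  induction r using FreeAlgebra.induction generalizing a with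
  | grade0 c =>
    obtain ⟨n, hn⟩ := ha
    refine ⟨n, fun w hw => ?_⟩
    have : algebraMap k (FreeAlgebra k Z) c * a - constTerm (algebraMap k _ c * a) • f =
        c • (a - constTerm a • f) := by
      rw [← Algebra.smul_def, map_smul, smul_sub, smul_assoc]
    rw [this, map_smul]
    exact U.smul_mem _ (hn w hw)
  | grade1 z =>
    classical
    obtain ⟨n, hn⟩ := ha
    refine ⟨n + 1, fun w hw => ?_⟩
    cases w with
    | nil => simp at hw
    | cons z' w =>
      simp only [opWord, map_mul, constTerm_ι, zero_mul, zero_smul, sub_zero,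
        Module.End.mul_apply, stateOp_apply, trans_ι_mul]
      split_ifs
      · exact hn w (by simpa using hw)
      · simp
  | mul r s hr hs => rw [mul_assoc]; exact hr (hs ha)
  | add r s hr hs =>
    obtain ⟨m, hm⟩ := hr ha
    obtain ⟨n, hn⟩ := hs ha
    refine ⟨max m n, fun w hw => ?_⟩
    rw [add_mul, map_add, add_smul, add_sub_add_comm, map_add]
    exact U.add_mem (hm w (le_trans (le_max_left _ _) hw)) (hn w (le_trans (le_max_right _ _) hw))

/-- For an irreducible `f`, the state space has no proper invariant subspaces. -/
lemma eq_bot_or_eq_stateSpace [Fintype Z] {f : FreeAlgebra k Z} (hf : constTerm f = 1)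
    (hconst : ∀ c, f ≠ algebraMap k _ c)
    (hirr : ∀ a b, f = a * b → (∃ c, a = algebraMap k _ c) ∨ ∃ c, b = algebraMap k _ c)
    {U : Submodule k (FreeAlgebra k Z)} (hU : U ≤ stateSpace f)
    (hinv : ∀ z, ∀ u ∈ U, stateOp f z u ∈ U) : U = ⊥ ∨ U = stateSpace f := by
  classical
  have hfact : Fact (constTerm f = 1) := ⟨hf⟩
  have hfd : FiniteDimensional k U := Submodule.finiteDimensional_of_le hU
  let e := Module.finBasis k U
  have hε : ∀ i, constTerm (e i : FreeAlgebra k Z) = 0 := fun i =>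
    constTerm_of_mem_stateSpace hf (hU (e i).2)
  let γ : Fin (Module.finrank k U) → Z → Fin (Module.finrank k U) → k := fun i z l =>
    e.repr ⟨stateOp f z (e i), hinv z _ (e i).2⟩ l
  have hγ : ∀ i z, ∑ l, γ i z l • (e l : FreeAlgebra k Z) = stateOp f z (e i) := by
    intro i z
    have := congrArg U.subtype (e.sum_repr ⟨stateOp f z (e i), hinv z _ (e i).2⟩)
    rw [map_sum] at this
    exact this
  let a : Option (Fin (Module.finrank k U)) → FreeAlgebra k Z := fun o => o.elim f fun i => e i
  let Q : Fin (Module.finrank k U) → Option (Fin (Module.finrank k U)) → FreeAlgebra k Z :=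
    fun i o => o.elim (-∑ z, constTerm (trans z (e i : FreeAlgebra k Z)) • FreeAlgebra.ι k z)
      fun l => (if l = i then 1 else 0) - ∑ z, γ i z l • FreeAlgebra.ι k z
  have ha : a ≠ 0 := by
    intro h
    have h2 : f = 0 := congr_fun h none
    simp [h2] at hf
  obtain ⟨f', hdiv, l, hl⟩ := exists_generator_of_relations (by simp) a ha Q
    (by
      intro i
      rw [Fintype.sum_option]
      simp only [Q, a, Option.elim, sub_mul, Finset.sum_sub_distrib, ite_mul, one_mul, zero_mul,
        Finset.sum_ite_eq', Finset.mem_univ, if_true, neg_mul, Finset.sum_mul]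
      rw [Finset.sum_comm]
      conv_lhs => enter [2, 1]; rw [eq_sum_stateOp (f := f) (hε i)]
      simp only [← hγ, Finset.mul_sum, Finset.sum_mul, mul_smul_comm, smul_mul_assoc]
      abel)
    (by
      intro c hc
      funext i
      have := hc (some i)
      simpa [Q, constTerm_ι, Finset.sum_ite_eq] using this)
  obtain ⟨p, hp⟩ := hdiv none
  have hbase : ∀ o, ∃ n, ∀ w : List Z, n ≤ w.length →
      opWord (stateOp f) w (a o - constTerm (a o) • f) ∈ U := by
    have hw : ∀ w : List Z, ∀ u ∈ U, opWord (stateOp f) w u ∈ U := by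
      intro w
      induction w with
      | nil => exact fun u hu => hu
      | cons z w ih => exact fun u hu => ih _ (hinv z u hu)
    intro o
    refine ⟨0, fun w _ => hw w _ ?_⟩
    cases o with
    | none => simp [a, hf]
    | some i => simp only [a, Option.elim, hε, zero_smul, sub_zero]; exact (e i).2
  have hsumtail : ∀ s : Finset (Option (Fin (Module.finrank k U))),
      ∃ n, ∀ w : List Z, n ≤ w.length → opWord (stateOp f) w
        ((∑ o ∈ s, l o * a o) - constTerm (∑ o ∈ s, l o * a o) • f) ∈ U := by
    intro s
    induction s using Finset.induction_on with
    | empty => exact ⟨0, by simp⟩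
    | insert o s ho ih =>
      obtain ⟨m, hm⟩ := exists_tail_mem (l o) (hbase o)
      obtain ⟨n, hn⟩ := ih
      refine ⟨max m n, fun w hw => ?_⟩
      rw [Finset.sum_insert ho, map_add, add_smul, add_sub_add_comm, map_add]
      exact U.add_mem (hm w (le_trans (le_max_left _ _) hw))
        (hn w (le_trans (le_max_right _ _) hw))
  rcases hirr p f' hp with ⟨c, hc⟩ | ⟨c, hc⟩
  · left
    have hc0 : c ≠ 0 := by
      rintro rfl
      apply hconst 0
      change f = p * f' at hp
      rw [hp, hc, map_zero, zero_mul]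
    have hf' : f' = c⁻¹ • f := by
      change f = p * f' at hp
      rw [hp, hc, ← Algebra.smul_def, inv_smul_smul₀ hc0]
    choose r hr using fun i => hdiv (some i)
    rw [Submodule.eq_bot_iff]
    intro u hu
    obtain ⟨s, hs⟩ : ∃ s, u = s * f := by
      refine ⟨∑ i, e.repr ⟨u, hu⟩ i • c⁻¹ • r i, ?_⟩
      have h1 := congrArg U.subtype (e.sum_repr ⟨u, hu⟩)
      rw [map_sum] at h1
      refine h1.symm.trans ?_
      rw [Finset.sum_mul]
      refine Finset.sum_congr rfl fun i _ => ?_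
      have h2 : (e i : FreeAlgebra k Z) = r i * f' := hr i
      rw [map_smul, Submodule.subtype_apply, h2, hf', smul_mul_assoc, smul_mul_assoc,
        mul_smul_comm]
    by_contra hu0
    have hlen := len_mul (left_ne_zero_of_mul (hs ▸ hu0)) (right_ne_zero_of_mul (hs ▸ hu0))
    have hule : len u ≤ len f := len_le_iff.2 (stateSpace_le_degLT hf (hU hu))
    rw [← hs] at hlen
    have hs1 := eq_algebraMap_of_mem_degLT_one (len_le_iff.1 (show len s ≤ 1 by omega))
    have hε0 := constTerm_of_mem_stateSpace hf (hU hu)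
    rw [hs, map_mul, hf, mul_one] at hε0
    rw [hε0, map_zero] at hs1
    rw [hs, hs1, zero_mul] at hu0
    exact hu0 rfl
  · right
    refine le_antisymm hU ?_
    have hc0 : c ≠ 0 := by
      rintro rfl
      apply hconst 0
      change f = p * f' at hp
      rw [hp, hc, map_zero, mul_zero]
    obtain ⟨n, hn⟩ := exists_tail_mem (algebraMap k _ c⁻¹) (hsumtail Finset.univ)
    rw [← hl, hc, ← map_mul, inv_mul_cancel₀ hc0, map_one] at hn
    exact stateSpace_le_of_long_words hf hconst n (by simpa using hn)

/-- If all operators attached to letters outside `S` vanish on the state space then `f` only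
involves letters in `S`. -/
lemma mem_adjoin_of_stateOp_eq_zero [Fintype Z] {f : FreeAlgebra k Z} (hf : constTerm f = 1)
    (S : Set Z) (h : ∀ z, z ∉ S → ∀ a ∈ stateSpace f, stateOp f z a = 0) :
    f ∈ Algebra.adjoin k (FreeAlgebra.ι k '' S) := by
  have h0 : len f ≠ 0 := by
    rw [Ne, len_eq_zero_iff]
    rintro rfl
    simp at hf
  obtain ⟨d, hd⟩ := Nat.exists_eq_succ_of_ne_zero h0
  have hstep : ∀ z, ∀ a ∈ stateSpace f, trans z a ∈ stateSpace f ⊔ k ∙ f := by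
    intro z a ha
    rw [← sub_add_cancel (trans z a) (constTerm (trans z a) • f)]
    exact Submodule.add_mem_sup (stateOp_mem_stateSpace z ha) (Submodule.smul_mem _ _
      (Submodule.mem_span_singleton_self f))
  have hkill : ∀ z, z ∉ S → ∀ a ∈ stateSpace f, trans z a = 0 := by
    intro z hz a ha
    have h1 := h z hz a ha
    rw [stateOp_apply, sub_eq_zero] at h1
    have h2 : trans z a ∈ degLT d := by
      have := stateSpace_le_degLT hf ha
      rw [hd] at this
      exact mem_degLT_succ.1 this z
    rw [h1]
    by_contra hne
    rw [h1, Submodule.smul_mem_iff _ (left_ne_zero_of_smul hne), ← len_le_iff] at h2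
    omega
  have hf1 : ∀ z, trans z f = - trans z (1 - f) := by simp
  have key : ∀ n, ∀ a ∈ stateSpace f ⊔ k ∙ f, a ∈ degLT n →
      a ∈ Algebra.adjoin k (FreeAlgebra.ι k '' S) := by
    intro n
    induction n with
    | zero => intro a _ ha; rw [mem_degLT_zero.1 ha]; exact Subalgebra.zero_mem _
    | succ n ih =>
      intro a ha han
      have hV : ∀ z, trans z a ∈ stateSpace f ⊔ k ∙ f ∧ (z ∉ S → trans z a = 0) := by
        intro z
        obtain ⟨b, hb, c, hc, rfl⟩ := Submodule.mem_sup.1 ha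
        obtain ⟨t, rfl⟩ := Submodule.mem_span_singleton.1 hc
        rw [map_add, map_smul, hf1]
        refine ⟨Submodule.add_mem _ (hstep z b hb) (Submodule.smul_mem _ _
          (Submodule.neg_mem _ (hstep z _ (one_sub_mem_stateSpace f)))), fun hz => ?_⟩
        rw [hkill z hz b hb, hkill z hz _ (one_sub_mem_stateSpace f)]
        simp
      rw [eq_constTerm_add_sum a]
      refine Subalgebra.add_mem _ (Subalgebra.algebraMap_mem _ _) (Subalgebra.sum_mem _ ?_)
      intro z _
      by_cases hz : z ∈ S
      · exact Subalgebra.mul_mem _ (Algebra.subset_adjoin ⟨z, hz, rfl⟩)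
          (ih _ (hV z).1 (mem_degLT_succ.1 han z))
      · rw [(hV z).2 hz, mul_zero]
        exact Subalgebra.zero_mem _
  exact key _ f (Submodule.mem_sup_right (Submodule.mem_span_singleton_self f)) (mem_degLT_len f)

/-- Words of length at most `l`. -/
abbrev BWord (Z : Type*) (l : ℕ) := {w : List Z // w.length ≤ l}

instance [Finite Z] (l : ℕ) : Fintype (BWord Z l) :=
  have : Finite (BWord Z l) := (List.finite_length_le Z l).to_subtype
  Fintype.ofFinite _

/-- The empty word. -/
def BWord.nil {l : ℕ} : BWord Z l := ⟨[], Nat.zero_le _⟩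

open Classical in
/-- The block matrix of the letter `z` built from the tree of words of length at most `l`: it
appends `z` to words, acts by `X z` on the block of the empty word, and has further entries
returning to the block of the empty word. -/
def treeMat {m : Type*} {l : ℕ} [Fintype Z] (X : Z → Matrix m m k)
    (a : Z → Z → BWord Z l → k) (z : Z) : Matrix (m × BWord Z l) (m × BWord Z l) k :=
  Matrix.of fun p u =>
    (if p.2.1 = z :: u.2.1 then if p.1 = u.1 then 1 else 0 else 0) +
      if p.2 = BWord.nil then
        (if u.2 = BWord.nil then X z p.1 u.1 else 0) - ∑ j, a j z u.2 * X j p.1 u.1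
      else 0

lemma treeMat_mulVec_nil {m : Type*} [Fintype m] {l : ℕ} [Fintype Z] (X : Z → Matrix m m k)
    (a : Z → Z → BWord Z l → k) (z : Z) (ψ : m × BWord Z l → k) (α : m) :
    (treeMat X a z *ᵥ ψ) (α, BWord.nil) = ∑ β, X z α β * ψ (β, BWord.nil) -
      ∑ j, ∑ β, X j α β * ∑ u, a j z u * ψ (β, u) := by
  classical
  simp only [Matrix.mulVec, dotProduct, treeMat, Matrix.of_apply, Fintype.sum_prod_type,
    if_true]
  have h : ∀ u : BWord Z l, ((BWord.nil : BWord Z l).1 = z :: u.1) = False := by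
    intro u; simp [BWord.nil]
  simp only [h, if_false, zero_add, sub_mul, Finset.sum_sub_distrib, ite_mul, zero_mul,
    Finset.sum_ite_eq', Finset.mem_univ, if_true]
  congr 1
  simp only [Finset.mul_sum, Finset.sum_mul]
  conv_rhs => rw [Finset.sum_comm]
  refine Finset.sum_congr rfl fun β _ => ?_
  rw [Finset.sum_comm]
  refine Finset.sum_congr rfl fun j _ => Finset.sum_congr rfl fun u _ => ?_
  ring

lemma treeMat_mulVec_cons {m : Type*} [Fintype m] {l : ℕ} [Fintype Z] (X : Z → Matrix m m k)
    (a : Z → Z → BWord Z l → k) (z z' : Z) (u : List Z) (hu : (z' :: u).length ≤ l)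
    (hu' : u.length ≤ l) (ψ : m × BWord Z l → k) (α : m) [Decidable (z' = z)] :
    (treeMat X a z *ᵥ ψ) (α, ⟨z' :: u, hu⟩) = if z' = z then ψ (α, ⟨u, hu'⟩) else 0 := by
  classical
  simp only [Matrix.mulVec, dotProduct, treeMat, Matrix.of_apply]
  have h : ((⟨z' :: u, hu⟩ : BWord Z l) = BWord.nil) = False := by simp [BWord.nil]
  simp only [h, if_false, add_zero]
  rw [Finset.sum_eq_single (α, ⟨u, hu'⟩)]
  · simp
  · rintro ⟨β, v, hv⟩ - hne
    split_ifs with h1 h2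
    · exfalso
      simp only [List.cons.injEq] at h1
      obtain ⟨-, rfl⟩ := h1
      exact hne (by simp only at h2; rw [h2])
    all_goals simp
  · simp

/-- If the operators of the letters carrying `X` are rewritten through longer words, the tree
matrices evaluate `f` to an invertible matrix. -/
lemma det_lift_treeMat_ne_zero {m : Type*} [Fintype m] [DecidableEq m] {l : ℕ} [Fintype Z]
    [DecidableEq (BWord Z l)]
    {f : FreeAlgebra k Z} (hf : constTerm f = 1) (S : Set Z) (X : Z → Matrix m m k)
    (hX : ∀ z, z ∉ S → X z = 0) (a : Z → Z → BWord Z l → k)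
    (ha : ∀ j ∈ S, ∀ e ∈ stateSpace f,
      stateOp f j e = ∑ z, ∑ u, a j z u • opWord (stateOp f) (z :: u.1) e) :
    (FreeAlgebra.lift k (treeMat X a) f).det ≠ 0 := by
  classical
  intro hdet
  obtain ⟨v, hv, hfv⟩ := Matrix.exists_mulVec_eq_zero_iff.2 hdet
  let φ : FreeAlgebra k Z →ₗ[k] (m × BWord Z l → k) :=
    { toFun := fun e => FreeAlgebra.lift k (treeMat X a) e *ᵥ v
      map_add' := fun e e' => by rw [map_add, Matrix.add_mulVec]
      map_smul' := fun c e => by simp [Matrix.smul_mulVec] }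
  have hφ : ∀ e, φ e = FreeAlgebra.lift k (treeMat X a) e *ᵥ v := fun _ => rfl
  have hstep : ∀ e ∈ stateSpace f, φ e = ∑ z, treeMat X a z *ᵥ φ (stateOp f z e) := by
    intro e he
    conv_lhs => rw [eq_sum_stateOp (f := f) (constTerm_of_mem_stateSpace hf he)]
    rw [map_add, map_sum]
    simp only [hφ, map_mul, ← Matrix.mulVec_mulVec, hfv, Matrix.mulVec_zero, add_zero,
      FreeAlgebra.lift_ι_apply]
  have hcons : ∀ (u : List Z) (hu : u.length ≤ l), ∀ e ∈ stateSpace f, ∀ α,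
      φ e (α, ⟨u, hu⟩) = φ (opWord (stateOp f) u e) (α, BWord.nil) := by
    intro u
    induction u with
    | nil => intro _ e _ α; rfl
    | cons z u ih =>
      intro hu e he α
      have hu' : u.length ≤ l := by simp at hu; omega
      rw [hstep e he, Finset.sum_apply]
      simp only [treeMat_mulVec_cons X a _ _ u hu hu']
      rw [Finset.sum_ite_eq, if_pos (Finset.mem_univ _), ih hu' _ (stateOp_mem_stateSpace z he)]
      rfl
  have hnil : ∀ e ∈ stateSpace f, ∀ α, φ e (α, BWord.nil) = 0 := by
    intro e he α
    rw [hstep e he, Finset.sum_apply]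
    simp only [treeMat_mulVec_nil, Finset.sum_sub_distrib]
    rw [sub_eq_zero, Finset.sum_comm (s := Finset.univ (α := Z)) (t := Finset.univ (α := Z))]
    refine Finset.sum_congr rfl fun j _ => ?_
    rw [Finset.sum_comm]
    refine Finset.sum_congr rfl fun β _ => ?_
    by_cases hj : j ∈ S
    · rw [ha j hj e he, ← Finset.mul_sum]
      congr 1
      simp only [map_sum, map_smul, Finset.sum_apply, Pi.smul_apply, smul_eq_mul]
      refine Finset.sum_congr rfl fun z _ => Finset.sum_congr rfl fun u _ => ?_
      rw [hcons u.1 u.2 _ (stateOp_mem_stateSpace z he)]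
      rfl
    · simp [hX j hj]
  have h0 : φ (1 - f) = 0 := by
    funext ⟨α, u, hu⟩
    have hw : ∀ (u : List Z), ∀ e ∈ stateSpace f, opWord (stateOp f) u e ∈ stateSpace f := by
      intro u
      induction u with
      | nil => exact fun e he => he
      | cons z u ih => exact fun e he => ih _ (stateOp_mem_stateSpace z he)
    rw [hcons u hu _ (one_sub_mem_stateSpace f),
      hnil _ (hw u _ (one_sub_mem_stateSpace f))]
    rfl
  rw [map_sub, hφ, hφ, hfv, map_one, Matrix.one_mulVec, sub_zero] at h0
  exact hv h0

/-- For irreducible `f` involving letters outside `S`, each operator of the state space is a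
combination of words containing a letter outside `S`. -/
lemma exists_coeff_of_irreducible [IsAlgClosed k] [Fintype Z] {f : FreeAlgebra k Z}
    (hf : constTerm f = 1)
    (hconst : ∀ c, f ≠ algebraMap k _ c)
    (hirr : ∀ a b, f = a * b → (∃ c, a = algebraMap k _ c) ∨ ∃ c, b = algebraMap k _ c)
    (S : Set Z) (hS : f ∉ Algebra.adjoin k (FreeAlgebra.ι k '' S)) :
    ∃ l₀, ∀ l ≥ l₀, ∃ a : Z → Z → BWord Z l → k,
      (∀ j z u, (∀ y ∈ z :: u.1, y ∈ S) → a j z u = 0) ∧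
      ∀ j, ∀ e ∈ stateSpace f,
        stateOp f j e = ∑ z, ∑ u, a j z u • opWord (stateOp f) (z :: u.1) e := by
  classical
  have hfact : Fact (constTerm f = 1) := ⟨hf⟩
  let C : Z → Module.End k (stateSpace f) := fun z =>
    (stateOp f z).restrict fun _ h => stateOp_mem_stateSpace z h
  have hC : ∀ (w : List Z) (e : stateSpace f),
      (opWord C w e : FreeAlgebra k Z) = opWord (stateOp f) w e := by
    intro w
    induction w with
    | nil => intro e; rfl
    | cons z w ih => intro e; exact ih (C z e)
  have hspan := span_opWord_eq_top C (fun U hU => by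
      rcases eq_bot_or_eq_stateSpace hf hconst hirr (U := U.map (stateSpace f).subtype)
        (Submodule.map_subtype_le _ _) (by
          rintro z _ ⟨u, hu, rfl⟩
          exact ⟨C z u, hU z u hu, rfl⟩) with h | h
      · left
        rw [Submodule.eq_bot_iff]
        intro u hu
        have hu' : (u : FreeAlgebra k Z) ∈ U.map (stateSpace f).subtype := ⟨u, hu, rfl⟩
        rw [h] at hu'
        exact Subtype.ext hu'
      · right
        rw [eq_top_iff]
        intro u _
        have hu : (u : FreeAlgebra k Z) ∈ U.map (stateSpace f).subtype := by
          rw [h]; exact u.2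
        obtain ⟨u', hu', he⟩ := hu
        exact Subtype.ext he ▸ hu')
    (fun z => z ∉ S) (by
      by_contra! hcon
      refine hS (mem_adjoin_of_stateOp_eq_zero hf S fun z hz a ha => ?_)
      exact congrArg Subtype.val (LinearMap.congr_fun (hcon z hz) ⟨a, ha⟩))
  let F : ℕ →o Submodule k (Module.End k (stateSpace f)) :=
    { toFun := fun l => Submodule.span k
        {T | ∃ w : List Z, w.length ≤ l ∧ (∃ z ∈ w, z ∉ S) ∧ opWord C w = T}
      monotone' := fun l l' hl => Submodule.span_mono fun T ⟨w, hw, h⟩ => ⟨w, hw.trans hl, h⟩ }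
  obtain ⟨l₀, hl₀⟩ := monotone_stabilizes_iff_noetherian.2
    (inferInstance : IsNoetherian k (Module.End k (stateSpace f))) F
  have htop : F l₀ = ⊤ := by
    rw [eq_top_iff, ← hspan]
    refine Submodule.span_le.2 ?_
    rintro T ⟨w, hw, rfl⟩
    have h1 : opWord C w ∈ F (max l₀ w.length) :=
      Submodule.subset_span ⟨w, le_max_right _ _, hw, rfl⟩
    rwa [← hl₀ _ (le_max_left _ _)] at h1
  refine ⟨l₀, fun l hl => ?_⟩
  have hmem : ∀ T : Module.End k (stateSpace f), ∃ b : Z → BWord Z l → k,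
      (∀ z u, (∀ y ∈ z :: u.1, y ∈ S) → b z u = 0) ∧
      T = ∑ z, ∑ u, b z u • opWord C (z :: u.1) := by
    intro T
    have hT : T ∈ F l₀ := htop ▸ Submodule.mem_top
    induction hT using Submodule.span_induction with
    | mem T hT =>
      obtain ⟨w, hwl, ⟨y, hy, hyS⟩, rfl⟩ := hT
      cases w with
      | nil => simp at hy
      | cons z w =>
        have hw : w.length ≤ l := by simp at hwl; omega
        refine ⟨fun z' u => if z' = z then if u = ⟨w, hw⟩ then 1 else 0 else 0, ?_, ?_⟩
        · intro z' u h
          dsimp only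
          split_ifs with h1 h2
          · subst h1 h2
            exact absurd (h y hy) hyS
          all_goals rfl
        · simp [ite_smul]
    | zero => exact ⟨0, by simp, by simp⟩
    | add T T' _ _ hT hT' =>
      obtain ⟨b, hb, rfl⟩ := hT
      obtain ⟨b', hb', rfl⟩ := hT'
      refine ⟨b + b', fun z u h => by simp [hb z u h, hb' z u h], ?_⟩
      simp [add_smul, Finset.sum_add_distrib]
    | smul c T _ hT =>
      obtain ⟨b, hb, rfl⟩ := hT
      refine ⟨c • b, fun z u h => by simp [hb z u h], ?_⟩
      simp [Finset.smul_sum, mul_smul]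
  choose b hb0 hb using fun j => hmem (C j)
  refine ⟨b, hb0, fun j e he => ?_⟩
  have h1 := congrArg Subtype.val (LinearMap.congr_fun (hb j) ⟨e, he⟩)
  refine h1.trans ?_
  simp [LinearMap.sum_apply, hC]

end FreeAlgebra

section Factors

variable {k : Type*} [Field k]

/-- The tuple of generic `N × N` matrices indexed by the letters of `Z`. -/
def genMat (k : Type*) [Field k] (Z N : Type*) : Z → Matrix N N (MvPolynomial (Z × N × N) k) :=
  fun z => Matrix.of fun a b => X (z, a, b)

/-- Evaluation of a polynomial in matrix entries at a tuple of matrices. -/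
def evalAt {R : Type*} [CommRing R] [Algebra k R] {Z N : Type*} (M : Z → Matrix N N R) :
    MvPolynomial (Z × N × N) k →ₐ[k] R :=
  aeval fun v => M v.1 v.2.1 v.2.2

lemma map_evalAt {R R' : Type*} [CommRing R] [Algebra k R] [CommRing R'] [Algebra k R']
    {Z N : Type*} (φ : R →ₐ[k] R') (M : Z → Matrix N N R) (q : MvPolynomial (Z × N × N) k) :
    φ (evalAt M q) = evalAt (fun z => (M z).map φ) q :=
  comp_aeval_apply _ _ _

lemma genMat_map_evalAt {R : Type*} [CommRing R] [Algebra k R] {Z N : Type*}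
    (M : Z → Matrix N N R) (z : Z) : (genMat k Z N z).map (evalAt M) = M z := by
  ext a b
  simp [genMat, evalAt]

lemma map_lift {Z A B : Type*} [Ring A] [Algebra k A] [Ring B] [Algebra k B] (φ : A →ₐ[k] B)
    (M : Z → A) (f : FreeAlgebra k Z) :
    φ (FreeAlgebra.lift k M f) = FreeAlgebra.lift k (fun z => φ (M z)) f := by
  rw [← AlgHom.comp_apply]
  congr 1
  ext z
  simp

lemma map_det_lift {Z N R R' : Type*} [Fintype N] [DecidableEq N] [CommRing R] [Algebra k R]
    [CommRing R'] [Algebra k R'] (φ : R →ₐ[k] R') (M : Z → Matrix N N R) (f : FreeAlgebra k Z) :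
    φ (FreeAlgebra.lift k M f).det = (FreeAlgebra.lift k (fun z => (M z).map φ) f).det := by
  rw [AlgHom.map_det, map_lift]
  rfl

lemma lift_intertwine {Z A : Type*} [Ring A] [Algebra k A] {M M' : Z → A} {W : A}
    (h : ∀ z, M z * W = W * M' z) (f : FreeAlgebra k Z) :
    FreeAlgebra.lift k M f * W = W * FreeAlgebra.lift k M' f := by
  induction f using FreeAlgebra.induction with
  | grade0 c => rw [AlgHom.commutes, AlgHom.commutes, Algebra.commutes]
  | grade1 z => simpa using h z
  | mul a b ha hb => rw [map_mul, map_mul, mul_assoc, hb, ← mul_assoc, ha, mul_assoc]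
  | add a b ha hb => rw [map_add, map_add, add_mul, ha, hb, mul_add]

lemma lift_zero_apply {Z A : Type*} [Ring A] [Algebra k A] (f : FreeAlgebra k Z) :
    FreeAlgebra.lift k (0 : Z → A) f = algebraMap k A (constTerm f) := by
  have := map_lift (Algebra.ofId k A) (fun _ : Z => (0 : k)) f
  rw [constTerm, ← Algebra.ofId_apply, this]
  simp only [map_zero]
  rfl

variable {G H : Type*}

/-- The determinant of `f` at generic matrices for the letters in `G` and zero matrices for the
letters in `H`. -/
def detX (f : FreeAlgebra k (G ⊕ H)) (N : Type*) [Fintype N] [DecidableEq N] :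
    MvPolynomial (G × N × N) k :=
  (FreeAlgebra.lift k (Sum.elim (genMat k G N) 0) f).det

lemma evalAt_detX {R : Type*} [CommRing R] [Algebra k R] (f : FreeAlgebra k (G ⊕ H))
    {N : Type*} [Fintype N] [DecidableEq N] (M : G → Matrix N N R) :
    evalAt M (detX f N) = (FreeAlgebra.lift k (Sum.elim M 0) f).det := by
  rw [detX, map_det_lift]
  congr 3
  funext z
  cases z with
  | inl j => simp [genMat_map_evalAt]
  | inr j => ext a b; simp

lemma evalAt_zero_detX {R : Type*} [CommRing R] [Algebra k R] {f : FreeAlgebra k (G ⊕ H)}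
    (hf : constTerm f = 1) {N : Type*} [Fintype N] [DecidableEq N] :
    evalAt (0 : G → Matrix N N R) (detX f N) = 1 := by
  have h : (Sum.elim 0 0 : G ⊕ H → Matrix N N R) = 0 := by
    funext z; cases z <;> rfl
  rw [evalAt_detX, h, lift_zero_apply, hf, map_one, det_one]

lemma detX_ne_zero {f : FreeAlgebra k (G ⊕ H)} (hf : constTerm f = 1) (N : Type*) [Fintype N]
    [DecidableEq N] : detX f N ≠ 0 := by
  intro h
  have := evalAt_zero_detX (R := k) hf (N := N)
  simp [h] at this

/-- `q` is a polynomial in the entries of the `G`-matrices dividing the determinant of `f` at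
generic matrices. -/
def IsXFactor (f : FreeAlgebra k (G ⊕ H)) {N : Type*} [Fintype N] [DecidableEq N]
    (q : MvPolynomial (G × N × N) k) : Prop :=
  rename (fun v : G × N × N => ((Sum.inl v.1 : G ⊕ H), v.2)) q ∣
    (FreeAlgebra.lift k (genMat k (G ⊕ H) N) f).det

section Factor

variable {f : FreeAlgebra k (G ⊕ H)} {N : Type*} [Fintype N] [DecidableEq N]
  {q : MvPolynomial (G × N × N) k}

lemma IsXFactor.evalAt_dvd (hq : IsXFactor f q) {R : Type*} [CommRing R] [Algebra k R]
    (M : G ⊕ H → Matrix N N R) :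
    evalAt (fun j => M (Sum.inl j)) q ∣ (FreeAlgebra.lift k M f).det := by
  have h := map_dvd (evalAt M) hq
  rw [map_det_lift] at h
  simp only [genMat_map_evalAt] at h
  convert h using 1
  rw [evalAt, evalAt, aeval_rename]
  rfl

lemma IsXFactor.dvd_detX (hq : IsXFactor f q) : q ∣ detX f N := by
  have h := hq.evalAt_dvd (Sum.elim (genMat k G N) 0)
  have hid : (evalAt (fun j => (Sum.elim (genMat k G N) 0 : G ⊕ H → _) (Sum.inl j)) :
      MvPolynomial (G × N × N) k →ₐ[k] _) = AlgHom.id k _ := by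
    ext v
    simp [evalAt, genMat]
  rwa [hid] at h

lemma IsXFactor.reindex (hq : IsXFactor f q) {N' : Type*} [Fintype N'] [DecidableEq N']
    (e : N ≃ N') :
    IsXFactor f (rename (fun v : G × N × N => (v.1, e v.2.1, e v.2.2)) q) := by
  have h := hq.evalAt_dvd (fun z => (genMat k (G ⊕ H) N' z).submatrix e e)
  have h1 : FreeAlgebra.lift k (fun z => (genMat k (G ⊕ H) N' z).submatrix e e) f =
      (FreeAlgebra.lift k (genMat k (G ⊕ H) N') f).submatrix e e := by
    have := map_lift (reindexAlgEquiv k (MvPolynomial ((G ⊕ H) × N' × N') k) e.symm).toAlgHom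
      (genMat k (G ⊕ H) N') f
    exact this.symm
  rw [h1, det_submatrix_equiv_self] at h
  rw [IsXFactor]
  convert h using 1
  rw [rename_rename, evalAt, rename_eq_aeval]
  rfl

/-- Block triangular perturbations do not change the value of a factor of `detX f N`. -/
lemma evalAt_add_of_weight (hq : q ∣ detX f N) {R : Type*} [CommRing R] [IsDomain R]
    [Algebra k R] (wt : N → ℕ) (M E : G → Matrix N N R)
    (hM : ∀ j a b, M j a b ≠ 0 → wt a = wt b) (hE : ∀ j a b, E j a b ≠ 0 → wt b < wt a)
    (hne : evalAt M (detX f N) ≠ 0) :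
    evalAt (fun j => M j + E j) q = evalAt M q := by
  let Mt : G → Matrix N N (Polynomial R) := fun j => Matrix.of fun a b =>
    Polynomial.C (M j a b) + Polynomial.X ^ (wt a - wt b) * Polynomial.C (E j a b)
  let CA : R →ₐ[k] Polynomial R := (Algebra.ofId R (Polynomial R)).restrictScalars k
  have hCA : ∀ r, CA r = Polynomial.C r := fun _ => rfl
  let ev : R → Polynomial R →ₐ[k] R := fun r => (Polynomial.aeval r).restrictScalars k
  have hev : ∀ r p, ev r p = Polynomial.eval r p := fun r p => by
    simp [ev, Polynomial.coe_aeval_eq_eval]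
  have h0 : ∀ p : MvPolynomial (G × N × N) k, ev 0 (evalAt Mt p) = evalAt M p := by
    intro p
    rw [map_evalAt]
    congr 2
    funext j
    ext a b
    by_cases h : E j a b = 0
    · simp [hev, Mt, h]
    · have := hE j a b h
      simp [hev, Mt, show wt a - wt b ≠ 0 by omega]
  have h1 : ∀ p : MvPolynomial (G × N × N) k,
      ev 1 (evalAt Mt p) = evalAt (fun j => M j + E j) p := by
    intro p
    rw [map_evalAt]
    congr 2
    funext j
    ext a b
    simp [hev, Mt]
  let W : Matrix N N (Polynomial R) := Matrix.diagonal fun a => Polynomial.X ^ wt a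
  have hW : W.det ≠ 0 := by
    rw [det_diagonal]
    exact Finset.prod_ne_zero_iff.2 fun a _ => pow_ne_zero _ Polynomial.X_ne_zero
  have hint := lift_intertwine (k := k)
    (M := (Sum.elim Mt 0 : G ⊕ H → Matrix N N (Polynomial R)))
    (M' := Sum.elim (fun j => (M j + E j).map CA) 0) (W := W) (by
      rintro (j | j)
      · ext1 a b
        simp only [Sum.elim_inl, W, Matrix.mul_diagonal, Matrix.diagonal_mul, Mt,
          Matrix.of_apply, Matrix.map_apply, Matrix.add_apply, hCA, Polynomial.C_add]
        rw [add_mul, mul_add]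
        congr 1
        · by_cases h : M j a b = 0
          · simp [h]
          · rw [hM j a b h, mul_comm]
        · by_cases h : E j a b = 0
          · simp [h]
          · have := hE j a b h
            rw [mul_right_comm, ← pow_add, Nat.sub_add_cancel this.le]
      · simp) f
  have hdet := congrArg Matrix.det hint
  rw [det_mul, det_mul, mul_comm] at hdet
  have hdet' := mul_left_cancel₀ hW hdet
  rw [← evalAt_detX, ← evalAt_detX, ← map_evalAt CA, hCA] at hdet'
  obtain ⟨o, ho⟩ := hq
  have hc : evalAt (fun j => M j + E j) (detX f N) ≠ 0 := by
    intro hc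
    rw [hc] at hdet'
    have := h0 (detX f N)
    rw [hdet'] at this
    simp at this
    exact hne this.symm
  have hprod : evalAt Mt q * evalAt Mt o =
      Polynomial.C (evalAt (fun j => M j + E j) (detX f N)) := by
    rw [← hdet', ho, map_mul]
  have hdeg : (evalAt Mt q).natDegree = 0 := by
    have h2 := congrArg Polynomial.natDegree hprod
    have hne2 : evalAt Mt q * evalAt Mt o ≠ 0 := by
      rw [hprod]; exact Polynomial.C_ne_zero.2 hc
    rw [Polynomial.natDegree_mul (left_ne_zero_of_mul hne2) (right_ne_zero_of_mul hne2),
      Polynomial.natDegree_C] at h2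
    omega
  rw [← h0, ← h1, Polynomial.eq_C_of_natDegree_eq_zero hdeg]
  simp [hev]

end Factor

/-- Over an algebraically closed field a polynomial without zeros is constant. -/
lemma exists_eq_C_of_forall_eval_ne_zero [IsAlgClosed k] {σ : Type*} [Finite σ]
    {r : MvPolynomial σ k} (h : ∀ x : σ → k, eval x r ≠ 0) : ∃ c, r = C c := by
  by_cases hr : IsUnit r
  · obtain ⟨c, -, hc⟩ := MvPolynomial.isUnit_iff_eq_C_of_isReduced.1 hr
    exact ⟨c, hc⟩
  · obtain ⟨I, hI, hrI⟩ := exists_max_ideal_of_mem_nonunits hr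
    obtain ⟨x, rfl⟩ := isMaximal_iff_eq_vanishingIdeal_singleton.1 hI
    refine absurd ?_ (h x)
    simpa [mem_vanishingIdeal_singleton_iff] using hrI

lemma injective_block {m c : Type*} (i : c) :
    Function.Injective (fun v : G × m × m => (v.1, (v.2.1, i), (v.2.2, i))) := by
  rintro ⟨j, a, b⟩ ⟨j', a', b'⟩ h
  simpa using h

open Classical in
/-- The matrix with `M` as its diagonal block of index `i` and zeros elsewhere. -/
def cornerMat {R m c : Type*} [Zero R] (i : c) (M : Matrix m m R) : Matrix (m × c) (m × c) R :=
  Matrix.of fun p u => if p.2 = i ∧ u.2 = i then M p.1 u.1 else 0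

lemma cornerMat_map {R R' m c : Type*} [Zero R] [Zero R'] (i : c) (M : Matrix m m R) (φ : R → R')
    (hφ : φ 0 = 0) : (cornerMat i M).map φ = cornerMat i (M.map φ) := by
  ext p u
  simp only [cornerMat, Matrix.map_apply, Matrix.of_apply]
  split_ifs <;> simp [hφ]

lemma cornerMat_zero {R m c : Type*} [Zero R] (i : c) :
    cornerMat i (0 : Matrix m m R) = 0 := by
  ext p u
  simp [cornerMat]

lemma evalAt_killCompl {R : Type*} [CommRing R] [Algebra k R] {m c : Type*} (i : c)
    (M : G → Matrix m m R) (q : MvPolynomial (G × (m × c) × (m × c)) k) :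
    evalAt M (killCompl (injective_block i) q) =
      evalAt (fun j => cornerMat i (M j)) q := by
  rw [← AlgHom.comp_apply]
  congr 1
  ext ⟨j, ⟨a, i'⟩, b, i''⟩
  simp only [AlgHom.comp_apply, killCompl, aeval_X, evalAt, cornerMat, Matrix.of_apply]
  split_ifs with h1 h2 h2
  · obtain ⟨⟨j', a', b'⟩, h1'⟩ := id h1
    have he : (Equiv.ofInjective _ (injective_block (G := G) (m := m) i)).symm
        ⟨(j, (a, i'), b, i''), h1⟩ = (j, a, b) := by
      rw [Equiv.symm_apply_eq]
      ext1
      simp at h1'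
      simp [h2.1, h2.2]
    rw [he]
    simp
  · obtain ⟨⟨j', a', b'⟩, h1'⟩ := id h1
    simp at h1'
    exact absurd ⟨h1'.2.1.2.symm, h1'.2.2.2.symm⟩ h2
  · exact absurd ⟨(j, a, b), by simp [h2.1, h2.2]⟩ h1
  · simp

lemma evalAt_eq_eval {N : Type*} (x : G × N × N → k) (q : MvPolynomial (G × N × N) k) :
    evalAt (fun j => Matrix.of fun a b => x (j, a, b)) q = eval x q := by
  rw [evalAt, ← coe_aeval_eq_eval]
  rfl

/-- A factor of `det f` in the `G`-variables is constant on the block of the empty word. -/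
lemma exists_killCompl_nil_eq_C [IsAlgClosed k] [Fintype G] [Fintype H] {m : Type*} [Fintype m]
    [DecidableEq m] {l : ℕ} [DecidableEq (BWord (G ⊕ H) l)] {f : FreeAlgebra k (G ⊕ H)}
    (hf : constTerm f = 1) (a : G ⊕ H → G ⊕ H → BWord (G ⊕ H) l → k)
    (ha : ∀ j z u, (∀ y ∈ z :: u.1, y ∈ Set.range (Sum.inl : G → G ⊕ H)) → a j z u = 0)
    (ha' : ∀ j, ∀ e ∈ stateSpace f,
      stateOp f j e = ∑ z, ∑ u, a j z u • opWord (stateOp f) (z :: u.1) e)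
    {q : MvPolynomial (G × (m × BWord (G ⊕ H) l) × (m × BWord (G ⊕ H) l)) k}
    (hq : IsXFactor f q) :
    ∃ c, killCompl (injective_block BWord.nil) q = C c := by
  classical
  refine exists_eq_C_of_forall_eval_ne_zero fun x hx => ?_
  let S : Set (G ⊕ H) := Set.range Sum.inl
  let X : G → Matrix m m k := fun j => Matrix.of fun a b => x (j, a, b)
  let M : G ⊕ H → Matrix (m × BWord (G ⊕ H) l) (m × BWord (G ⊕ H) l) k :=
    treeMat (Sum.elim X 0) a
  have hdet : (FreeAlgebra.lift k M f).det ≠ 0 :=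
    det_lift_treeMat_ne_zero hf S _ (by
      rintro (j | j) hj
      · exact absurd ⟨j, rfl⟩ hj
      · rfl) a fun j _ => ha' j
  let E : G → Matrix (m × BWord (G ⊕ H) l) (m × BWord (G ⊕ H) l) k :=
    fun j => M (Sum.inl j) - cornerMat BWord.nil (X j)
  let wt : m × BWord (G ⊕ H) l → ℕ := fun p =>
    p.2.1.length + if ∀ y ∈ p.2.1, y ∈ S then l + 1 else 0
  have hE : ∀ j p u, E j p u ≠ 0 → wt u < wt p := by
    rintro j ⟨p, p', hp⟩ ⟨u, u', hu⟩ h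
    by_cases h1 : p' = Sum.inl j :: u'
    · subst h1
      have : (∀ y ∈ Sum.inl j :: u', y ∈ S) ↔ ∀ y ∈ u', y ∈ S := by
        simp [S]
      simp only [wt, this, List.length_cons]
      omega
    · by_cases h2 : p' = []
      · subst h2
        have h3 : ¬ ∀ y ∈ u', y ∈ S := by
          intro h3
          apply h
          have h4 : ∀ i, a i (Sum.inl j) ⟨u', hu⟩ = 0 := by
            intro i
            apply ha
            simpa [S] using h3
          simp [E, M, treeMat, cornerMat, BWord.nil, h4]
        simp only [wt, List.not_mem_nil, false_imp_iff, implies_true, if_true, h3, if_false,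
          List.length_nil]
        omega
      · exact absurd (by simp [E, M, treeMat, cornerMat, BWord.nil, h1, h2]) h
  have hgen := evalAt_add_of_weight hq.dvd_detX (R := MvPolynomial (G × m × m) k) wt
    (fun j => cornerMat BWord.nil (genMat k G m j))
    (fun j => (E j).map (C : k → MvPolynomial (G × m × m) k)) (by
      intro j p u h
      simp only [cornerMat, Matrix.of_apply, ne_eq, ite_eq_right_iff, Classical.not_imp] at h
      simp only [wt, h.1.1, h.1.2])
    (fun j p u h => hE j p u fun h0 => h (by simp [h0])) (by
      intro h0
      have h1 := congrArg (evalAt (0 : G → Matrix m m k)) h0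
      rw [map_evalAt] at h1
      simp only [cornerMat_map _ _ _ (map_zero _), genMat_map_evalAt, Pi.zero_apply,
        cornerMat_zero] at h1
      have h2 := evalAt_zero_detX (R := k) hf (N := m × BWord (G ⊕ H) l)
      rw [map_zero] at h1
      exact one_ne_zero (h2.symm.trans h1))
  have hspec := congrArg (evalAt X) hgen
  rw [map_evalAt, map_evalAt] at hspec
  have h1 : ∀ j, (cornerMat BWord.nil (genMat k G m j) + (E j).map C).map (evalAt X) =
      M (Sum.inl j) := by
    intro j
    rw [Matrix.map_add _ (map_add _), cornerMat_map _ _ _ (map_zero _), genMat_map_evalAt]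
    have : ((E j).map C).map (evalAt X) = E j := by
      ext p u
      simp [evalAt]
    rw [this]
    exact add_sub_cancel _ _
  simp only [h1, cornerMat_map _ _ _ (map_zero _), genMat_map_evalAt] at hspec
  have h3 := hq.evalAt_dvd M
  rw [hspec, ← evalAt_killCompl, evalAt_eq_eval, hx, zero_dvd_iff] at h3
  exact hdet h3

lemma coeff_aeval_C_mul_X {σ : Type*} (x : σ → k) (P : MvPolynomial σ k) (d : ℕ) :
    (aeval (fun v => Polynomial.C (x v) * Polynomial.X) P).coeff d =
      eval x (homogeneousComponent d P) := by
  induction P using MvPolynomial.induction_on' with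
  | monomial s a =>
    have h : (aeval (fun v => Polynomial.C (x v) * Polynomial.X)) (monomial s a) =
        Polynomial.C (eval x (monomial s a)) * Polynomial.X ^ s.degree := by
      simp only [aeval_monomial, eval_monomial, Finsupp.prod, mul_pow, Finset.prod_mul_distrib,
        Finset.prod_pow_eq_pow_sum, Polynomial.algebraMap_eq, Polynomial.C_mul, map_prod,
        Polynomial.C_pow, mul_assoc]
      rfl
    rw [h, Polynomial.coeff_C_mul_X_pow, homogeneousComponent_of_mem
      (isHomogeneous_monomial a (n := s.degree) rfl)]
    split_ifs <;> simp
  | add p q hp hq => simp only [map_add, Polynomial.coeff_add, hp, hq]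

lemma natDegree_C_mul_X_le (a : k) : (Polynomial.C a * Polynomial.X).natDegree ≤ 1 :=
  (Polynomial.natDegree_C_mul_le _ _).trans Polynomial.natDegree_X_le

lemma natDegree_aeval_single_X_le {c : Type*} [DecidableEq c] (i : c) (O : MvPolynomial c k) :
    (aeval (Pi.single i Polynomial.X : c → Polynomial k) O).natDegree ≤ degreeOf i O := by
  rw [aeval_def, eval₂_eq]
  refine Polynomial.natDegree_sum_le_of_forall_le _ _ fun s hs => ?_
  refine (Polynomial.natDegree_C_mul_le _ _).trans ((Polynomial.natDegree_prod_le _ _).trans ?_)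
  refine le_trans ?_ (le_degreeOf_of_mem_support i hs)
  calc _ ≤ ∑ v ∈ s.support, if v = i then s i else 0 := Finset.sum_le_sum fun v _ => by
        refine Polynomial.natDegree_pow_le.trans ?_
        by_cases h : v = i
        · subst h; simp
        · simp [h]
    _ ≤ s i := by
        rw [Finset.sum_ite_eq']
        split_ifs <;> simp

lemma degreeOf_aeval_X_le {c : Type*} [DecidableEq c] (i i' : c) (p : Polynomial k) :
    degreeOf i (Polynomial.aeval (X i' : MvPolynomial c k) p) ≤
      if i = i' then p.natDegree else 0 := by
  rw [Polynomial.aeval_eq_sum_range]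
  refine (degreeOf_sum_le _ _ _).trans (Finset.sup_le fun n hn => ?_)
  rw [smul_eq_C_mul]
  refine (degreeOf_C_mul_le _ _ _).trans ((degreeOf_pow_le _ _ _).trans ?_)
  rw [degreeOf_X]
  split_ifs with h
  · simpa using Nat.lt_succ_iff.1 (Finset.mem_range.1 hn)
  · simp

/-- The block diagonal tuple with the scalar multiples `r i • X` as blocks. -/
def scaledBlocks {R m c : Type*} [CommRing R] [Algebra k R] [DecidableEq c]
    (X : G → Matrix m m k) (r : c → R) (j : G) : Matrix (m × c) (m × c) R :=
  blockDiagonal fun i => r i • (X j).map (algebraMap k R)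

lemma lift_blockDiagonal {Z R m c : Type*} [CommRing R] [Algebra k R] [Fintype m]
    [DecidableEq m] [Fintype c] [DecidableEq c] (M : Z → c → Matrix m m R)
    (f : FreeAlgebra k Z) :
    FreeAlgebra.lift k (fun z => blockDiagonal (M z)) f =
      blockDiagonal fun i => FreeAlgebra.lift k (fun z => M z i) f := by
  induction f using FreeAlgebra.induction with
  | grade0 a =>
    simp only [AlgHom.commutes]
    simp only [Algebra.algebraMap_eq_smul_one]
    rw [← blockDiagonal_one, ← blockDiagonal_smul]
    rfl
  | grade1 z => simp
  | mul a b ha hb => simp only [map_mul, ha, hb]; rw [← blockDiagonal_mul]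
  | add a b ha hb => simp only [map_add, ha, hb]; rw [← blockDiagonal_add]; rfl

lemma evalAt_scaledBlocks_detX {R m c : Type*} [CommRing R] [Algebra k R] [Fintype m]
    [DecidableEq m] [Fintype c] [DecidableEq c] (f : FreeAlgebra k (G ⊕ H))
    (X : G → Matrix m m k) (r : c → R) :
    evalAt (scaledBlocks X r) (detX f (m × c)) = ∏ i, Polynomial.aeval (r i)
      (evalAt (fun j => (Polynomial.X : Polynomial k) • (X j).map Polynomial.C) (detX f m)) := by
  have h : (Sum.elim (scaledBlocks X r) 0 : G ⊕ H → Matrix (m × c) (m × c) R) = fun z =>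
      blockDiagonal fun i => (Sum.elim (fun j => r i • (X j).map (algebraMap k R)) 0 :
        G ⊕ H → Matrix m m R) z := by
    funext z
    cases z with
    | inl j => rfl
    | inr j => simp only [Sum.elim_inr]; exact blockDiagonal_zero.symm
  rw [evalAt_detX, h, lift_blockDiagonal, det_blockDiagonal]
  refine Finset.prod_congr rfl fun i _ => ?_
  have hY : (fun j => ((Polynomial.X : Polynomial k) • (X j).map Polynomial.C).map
      (Polynomial.aeval (r i))) = fun j => r i • (X j).map (algebraMap k R) := by
    funext j
    ext a b
    simp only [Matrix.smul_apply, smul_eq_mul, Matrix.map_apply, map_mul, Polynomial.aeval_X,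
      Polynomial.aeval_C]
  rw [map_evalAt, hY, evalAt_detX]

lemma map_scaledBlocks {R R' m c : Type*} [CommRing R] [Algebra k R] [CommRing R']
    [Algebra k R'] [DecidableEq c] (φ : R →ₐ[k] R') (X : G → Matrix m m k) (r : c → R) (j : G) :
    (scaledBlocks X r j).map φ = scaledBlocks X (fun i => φ (r i)) j := by
  rw [scaledBlocks, scaledBlocks, blockDiagonal_map _ _ (map_zero φ)]
  congr 1
  funext i
  ext a b
  simp

/-- A factor of `detX f (m × c)` which is constant on all diagonal blocks has small degree. -/
lemma totalDegree_add_le_of_killCompl_eq_C [Infinite k] [Finite G] {m c : Type*} [Fintype m]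
    [DecidableEq m] [Fintype c] [DecidableEq c] {f : FreeAlgebra k (G ⊕ H)}
    (hf : constTerm f = 1) {q : MvPolynomial (G × (m × c) × (m × c)) k}
    (hq : q ∣ detX f (m × c)) (hc : ∀ i : c, ∃ d, killCompl (injective_block i) q = C d) :
    q.totalDegree + Fintype.card c * (detX f m).totalDegree ≤
      (detX f (m × c)).totalDegree := by
  obtain ⟨o, ho⟩ := hq
  have hdet := detX_ne_zero hf (m × c)
  have hqo : q * o ≠ 0 := ho ▸ hdet
  rw [ho, totalDegree_mul_of_isDomain (left_ne_zero_of_mul hqo) (right_ne_zero_of_mul hqo)]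
  refine Nat.add_le_add_left ?_ _
  set D := (detX f m).totalDegree with hD
  obtain ⟨x, hx⟩ : ∃ x, eval x (homogeneousComponent D (detX f m)) ≠ 0 := by
    by_contra! h
    have h0 : homogeneousComponent D (detX f m) = 0 := MvPolynomial.funext (by simpa using h)
    obtain ⟨s, hs, hs'⟩ := Finset.exists_mem_eq_sup (detX f m).support
      (support_nonempty.2 (detX_ne_zero hf m)) fun s => s.sum fun _ e => e
    have h1 : D = s.degree := hs'
    have h2 := congrArg (coeff s) h0
    rw [coeff_homogeneousComponent, if_pos h1.symm, coeff_zero] at h2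
    exact mem_support_iff.1 hs h2
  let Y : G → Matrix m m k := fun j => Matrix.of fun a b => x (j, a, b)
  set p : Polynomial k :=
    evalAt (fun j => (Polynomial.X : Polynomial k) • (Y j).map Polynomial.C) (detX f m) with hp
  have hp' : p = aeval (fun v => Polynomial.C (x v) * Polynomial.X) (detX f m) := by
    rw [hp, evalAt]
    congr 2
    funext v
    simp only [Y, Matrix.smul_apply, smul_eq_mul, Matrix.map_apply, Matrix.of_apply]
    exact mul_comm _ _
  have hpD : p.natDegree = D := by
    apply Polynomial.natDegree_eq_of_le_of_coeff_ne_zero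
    · rw [hp', ← mul_one D]
      exact aeval_natDegree_le _ le_rfl _ fun v => natDegree_C_mul_X_le _
    · rwa [hp', coeff_aeval_C_mul_X]
  have hp0 : Polynomial.aeval (0 : Polynomial k) p = 1 := by
    rw [hp, map_evalAt, ← evalAt_zero_detX (G := G) (R := Polynomial k) hf (N := m)]
    congr 2
    funext j
    ext a b : 1
    simp
  have hpne : p ≠ 0 := by
    intro h
    rw [h, map_zero] at hp0
    exact zero_ne_one hp0
  have hprod : evalAt (scaledBlocks Y (X : c → MvPolynomial c k)) q *
      evalAt (scaledBlocks Y X) o = ∏ i, Polynomial.aeval (X i) p := by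
    rw [← map_mul, ← ho, evalAt_scaledBlocks_detX]
  set Q := evalAt (scaledBlocks Y (X : c → MvPolynomial c k)) q with hQ
  set O := evalAt (scaledBlocks Y (X : c → MvPolynomial c k)) o with hO
  have hpne' : ∀ i : c, Polynomial.aeval (X i : MvPolynomial c k) p ≠ 0 := by
    intro i h
    have := congrArg (aeval (fun _ : c => (0 : Polynomial k))) h
    rw [map_zero, ← Polynomial.aeval_algHom_apply, aeval_X, hp0] at this
    exact one_ne_zero this
  have hQO : Q * O ≠ 0 := hprod ▸ Finset.prod_ne_zero_iff.2 fun i _ => hpne' i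
  have hQdeg : ∀ i, degreeOf i Q = 0 := by
    intro i
    have h1 : degreeOf i Q + degreeOf i O ≤ D := by
      rw [← degreeOf_mul_eq (left_ne_zero_of_mul hQO) (right_ne_zero_of_mul hQO), hprod]
      refine (degreeOf_prod_le _ _ _).trans ((Finset.sum_le_sum fun i' _ =>
        degreeOf_aeval_X_le i i' p).trans ?_)
      simp [hpD]
    obtain ⟨d, hd⟩ := hc i
    let φ : MvPolynomial c k →ₐ[k] Polynomial k := aeval (Pi.single i Polynomial.X)
    have h2 : φ Q = Polynomial.C d := by
      have h3 := evalAt_killCompl i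
        (fun j => (Polynomial.X : Polynomial k) • (Y j).map Polynomial.C) q
      rw [hd, evalAt, algHom_C] at h3
      rw [hQ, map_evalAt, ← Polynomial.algebraMap_eq, h3]
      congr 2
      funext j
      rw [map_scaledBlocks]
      ext ⟨a, i'⟩ ⟨b, i''⟩ : 1
      have h9 : ∀ i', φ (X i') = if i' = i then Polynomial.X else 0 := fun i' => by
        simp [φ, Pi.single_apply]
      simp only [scaledBlocks, blockDiagonal_apply, cornerMat, Matrix.of_apply, h9]
      by_cases h4 : i' = i
      · by_cases h5 : i'' = i
        · simp [h4, h5]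
        · simp [h4, h5, Ne.symm h5]
      · by_cases h5 : i' = i''
        · subst h5
          rw [if_pos rfl, if_neg h4, if_neg fun h => h4 h.1, zero_smul, Matrix.zero_apply]
        · simp [h4, h5]
    have h4 : φ Q * φ O = p := by
      rw [← map_mul, hprod, map_prod, Finset.prod_eq_single i]
      · rw [← Polynomial.aeval_algHom_apply]
        simp [φ]
      · intro i' _ hi'
        rw [← Polynomial.aeval_algHom_apply]
        simpa [φ, hi'] using hp0
      · simp
    have h5 := congrArg Polynomial.natDegree h4
    have h6 : φ Q * φ O ≠ 0 := h4 ▸ hpne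
    rw [Polynomial.natDegree_mul (left_ne_zero_of_mul h6) (right_ne_zero_of_mul h6), h2,
      Polynomial.natDegree_C, hpD] at h5
    have h7 : (φ O).natDegree ≤ degreeOf i O := natDegree_aeval_single_X_le i O
    omega
  obtain ⟨d, hd⟩ : ∃ d, Q = C d := by
    refine ⟨_, vars_eq_empty_iff_eq_C.1 ?_⟩
    refine Finset.eq_empty_of_forall_notMem fun i => ?_
    rw [mem_vars_iff_degreeOf_ne_zero, hQdeg]
    simp
  let φ : MvPolynomial c k →ₐ[k] Polynomial k := aeval fun _ => Polynomial.X
  have h1 : Polynomial.C d * φ O = p ^ Fintype.card c := by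
    rw [← Polynomial.algebraMap_eq, ← algHom_C φ d, ← hd, ← map_mul, hprod, map_prod,
      Finset.prod_eq_pow_card (b := p)]
    · rfl
    · intro i _
      rw [← Polynomial.aeval_algHom_apply]
      simp [φ]
  have h2 := congrArg Polynomial.natDegree h1
  have hd0 : d ≠ 0 := by
    rintro rfl
    exact left_ne_zero_of_mul hQO (by simp [hd])
  rw [Polynomial.natDegree_C_mul hd0, Polynomial.natDegree_pow, hpD] at h2
  rw [← h2, hO, map_evalAt]
  refine (aeval_natDegree_le o le_rfl _ (n := 1) fun v => ?_).trans (mul_one _).le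
  have h3 := congrFun₂ (map_scaledBlocks φ Y X v.1) v.2.1 v.2.2
  refine (congrArg Polynomial.natDegree h3).trans_le ?_
  simp only [scaledBlocks, blockDiagonal_apply]
  split_ifs
  · simp only [φ, aeval_X, Matrix.smul_apply, smul_eq_mul, Matrix.map_apply,
      Polynomial.algebraMap_eq]
    rw [mul_comm]
    exact natDegree_C_mul_X_le _
  · simp

lemma totalDegree_detX_le_of_equiv (f : FreeAlgebra k (G ⊕ H)) {N N' : Type*} [Fintype N]
    [DecidableEq N] [Fintype N'] [DecidableEq N'] (e : N ≃ N') :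
    (detX f N').totalDegree ≤ (detX f N).totalDegree := by
  have h : rename (fun v : G × N × N => (v.1, e v.2.1, e v.2.2)) (detX f N) = detX f N' := by
    have h1 : rename (fun v : G × N × N => (v.1, e v.2.1, e v.2.2)) (detX f N) =
        evalAt (fun j => (genMat k G N' j).submatrix e e) (detX f N) := by
      rw [evalAt, rename_eq_aeval]
      rfl
    have h2 := map_lift (reindexAlgEquiv k (MvPolynomial (G × N' × N') k) e.symm).toAlgHom
      (Sum.elim (genMat k G N') 0 : G ⊕ H → _) f
    have h3 : (Sum.elim (fun j => (genMat k G N' j).submatrix e e) 0 : G ⊕ H → _) = fun z =>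
        (reindexAlgEquiv k (MvPolynomial (G × N' × N') k) e.symm).toAlgHom
          ((Sum.elim (genMat k G N') 0 : G ⊕ H → _) z) := by
      funext z
      cases z <;> rfl
    rw [h1, evalAt_detX, h3, ← h2]
    exact det_submatrix_equiv_self e _
  rw [← h]
  exact totalDegree_rename_le _ _

lemma totalDegree_detX_congr (f : FreeAlgebra k (G ⊕ H)) {N N' : Type*} [Fintype N]
    [DecidableEq N] [Fintype N'] [DecidableEq N'] (e : N ≃ N') :
    (detX f N').totalDegree = (detX f N).totalDegree :=
  le_antisymm (totalDegree_detX_le_of_equiv f e) (totalDegree_detX_le_of_equiv f e.symm)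

lemma exists_totalDegree_lift_le {Z : Type*} (f : FreeAlgebra k Z) :
    ∃ δ : ℕ, ∀ (σ : Type w) (n : ℕ) (M : Z → Matrix (Fin n) (Fin n) (MvPolynomial σ k)),
      (∀ z a b, (M z a b).totalDegree ≤ 1) →
      ∀ a b, (FreeAlgebra.lift k M f a b).totalDegree ≤ δ := by
  induction f using FreeAlgebra.induction with
  | grade0 c =>
    refine ⟨0, fun σ n M _ a b => ?_⟩
    rw [AlgHom.commutes, Matrix.algebraMap_matrix_apply]
    split_ifs <;> simp [algebraMap_eq]
  | grade1 z => exact ⟨1, fun σ n M h a b => by simpa using h z a b⟩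
  | mul f g hf hg =>
    obtain ⟨δ, hδ⟩ := hf
    obtain ⟨δ', hδ'⟩ := hg
    refine ⟨δ + δ', fun σ n M h a b => ?_⟩
    rw [map_mul, Matrix.mul_apply]
    exact totalDegree_finsetSum_le fun i _ => (totalDegree_mul _ _).trans
      (add_le_add (hδ σ n M h a i) (hδ' σ n M h i b))
  | add f g hf hg =>
    obtain ⟨δ, hδ⟩ := hf
    obtain ⟨δ', hδ'⟩ := hg
    refine ⟨max δ δ', fun σ n M h a b => ?_⟩
    rw [map_add, Matrix.add_apply]
    exact (totalDegree_add _ _).trans (max_le_max (hδ σ n M h a b) (hδ' σ n M h a b))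

lemma totalDegree_det_le {σ : Type*} {n δ : ℕ} {M : Matrix (Fin n) (Fin n) (MvPolynomial σ k)}
    (h : ∀ a b, (M a b).totalDegree ≤ δ) : M.det.totalDegree ≤ δ * n := by
  rw [det_apply]
  refine totalDegree_finsetSum_le fun τ _ => ?_
  rw [Units.smul_def, zsmul_eq_mul, ← map_intCast (C : k →+* MvPolynomial σ k)]
  refine (totalDegree_mul _ _).trans ?_
  rw [totalDegree_C, zero_add]
  refine (totalDegree_finsetProd _ _).trans ((Finset.sum_le_sum fun i _ => h _ _).trans ?_)
  simp [mul_comm]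

lemma exists_totalDegree_detX_le (f : FreeAlgebra k (G ⊕ H)) :
    ∃ δ : ℕ, ∀ n : ℕ, (detX f (Fin n)).totalDegree ≤ δ * n := by
  obtain ⟨δ, hδ⟩ := exists_totalDegree_lift_le f
  refine ⟨δ, fun n => totalDegree_det_le (hδ _ n _ ?_)⟩
  rintro (j | j) a b
  · simp [genMat]
  · simp

open Filter in
lemma eventually_succ_lt_of_le_mul_pow {c δ : ℕ} (hc : 0 < c) {d : ℕ → ℕ}
    (h1 : ∀ s, c * d s ≤ d (s + 1)) (h2 : ∀ s, d s ≤ δ * c ^ s) :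
    ∀ᶠ s in atTop, 2 * d (s + 1) < 2 * (c * d s) + c ^ s := by
  let b : ℕ → ℝ := fun s => d s / c ^ s
  have hc' : (0 : ℝ) < c := by exact_mod_cast hc
  have hmono : Monotone b := monotone_nat_of_le_succ fun s => by
    simp only [b]
    rw [div_le_div_iff₀ (by positivity) (by positivity), pow_succ]
    have : (c : ℝ) * d s ≤ d (s + 1) := by exact_mod_cast h1 s
    nlinarith [pow_pos hc' s]
  have hbdd : BddAbove (Set.range b) := by
    refine ⟨δ, ?_⟩
    rintro _ ⟨s, rfl⟩
    simp only [b]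
    rw [div_le_iff₀ (by positivity)]
    exact_mod_cast h2 s
  have hlim := tendsto_atTop_ciSup hmono hbdd
  have hdiff := ((tendsto_add_atTop_iff_nat 1).2 hlim).sub hlim
  rw [sub_self] at hdiff
  filter_upwards [hdiff.eventually_lt_const (show (0 : ℝ) < 1 / (2 * c) by positivity)] with s hs
  simp only [b] at hs
  rw [div_sub_div _ _ (by positivity) (by positivity), div_lt_div_iff₀ (by positivity)
    (by positivity), pow_succ] at hs
  have hp := pow_pos hc' s
  have : (2 * d (s + 1) : ℝ) < 2 * (c * d s) + c ^ s := by
    by_contra! h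
    have : (0 : ℝ) < c ^ s * c := by positivity
    nlinarith [mul_le_mul_of_nonneg_left h this.le]
  exact_mod_cast this

/-- A polynomial of small degree in matrix entries is constant if, in every ordering of the
indices, it is constant on the block of index `i`. -/
lemma exists_eq_C_of_killCompl_rename {m c : Type*} [Fintype m] [DecidableEq m] [Fintype c]
    [DecidableEq c] (i : c) {q : MvPolynomial (G × (m × c) × (m × c)) k}
    (hdeg : 2 * q.totalDegree ≤ Fintype.card m)
    (h : ∀ e : m × c ≃ m × c, ∃ d, killCompl (injective_block i)
      (rename (fun v : G × (m × c) × (m × c) => (v.1, e v.2.1, e v.2.2)) q) = C d) :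
    ∃ d, q = C d := by
  classical
  by_contra! hq
  obtain ⟨s, hs, hs0⟩ : ∃ s ∈ q.support, s ≠ 0 := by
    by_contra! hs
    refine hq (coeff 0 q) (MvPolynomial.ext _ _ fun s => ?_)
    rw [coeff_C]
    split_ifs with h0
    · rw [h0]
    · by_contra hs'
      exact h0 (hs s (mem_support_iff.2 hs')).symm
  let T : Finset (m × c) := s.support.image (fun v => v.2.1) ∪ s.support.image (fun v => v.2.2)
  have hT : T.card ≤ Fintype.card m := by
    have h1 : s.support.card ≤ s.degree := by
      rw [Finsupp.degree, Finset.card_eq_sum_ones]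
      exact Finset.sum_le_sum fun v hv => Nat.one_le_iff_ne_zero.2 (Finsupp.mem_support_iff.1 hv)
    have h2 : s.degree ≤ q.totalDegree := le_totalDegree hs
    refine (Finset.card_union_le _ _).trans ?_
    have h3 := Finset.card_image_le (s := s.support) (f := fun v => v.2.1)
    have h4 := Finset.card_image_le (s := s.support) (f := fun v => v.2.2)
    omega
  let B : Finset (m × c) := Finset.univ ×ˢ {i}
  have hB : B.card = Fintype.card m := by simp [B, Finset.card_univ]
  obtain ⟨T', hTT', hT'⟩ := Finset.exists_superset_card_eq hT
    (hB ▸ Finset.card_le_univ B)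
  let e : m × c ≃ m × c :=
    (Finset.equivOfCardEq (hT'.trans hB.symm) : {x // x ∈ T'} ≃ {x // x ∈ B}).extendSubtype
  have he : ∀ x ∈ T, (e x).2 = i := fun x hx => by
    have := Equiv.extendSubtype_mem
      (Finset.equivOfCardEq (hT'.trans hB.symm) : {x // x ∈ T'} ≃ {x // x ∈ B}) x (hTT' hx)
    exact Finset.mem_singleton.1 (Finset.mem_product.1 this).2
  obtain ⟨d, hd⟩ := h e
  let ρ : G × (m × c) × (m × c) → G × (m × c) × (m × c) := fun v => (v.1, e v.2.1, e v.2.2)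
  have hρ : Function.Injective ρ := by
    rintro ⟨j, a, b⟩ ⟨j', a', b'⟩ h
    simpa [ρ] using h
  let π : G × (m × c) × (m × c) → G × m × m := fun v => (v.1, (e v.2.1).1, (e v.2.2).1)
  have hπ : (s.mapDomain π).mapDomain (fun v : G × m × m => (v.1, (v.2.1, i), (v.2.2, i))) =
      s.mapDomain ρ := by
    rw [← Finsupp.mapDomain_comp]
    refine Finsupp.mapDomain_congr fun v hv => ?_
    have h1 := he v.2.1 (Finset.mem_union_left _ (Finset.mem_image_of_mem _ hv))
    have h2 := he v.2.2 (Finset.mem_union_right _ (Finset.mem_image_of_mem _ hv))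
    simp only [Function.comp_apply, π, ρ]
    nth_rewrite 1 [← h1]
    nth_rewrite 1 [← h2]
    rfl
  have hco := congrArg (coeff (s.mapDomain π)) hd
  rw [coeff_killCompl, hπ, coeff_rename_mapDomain ρ hρ, coeff_C, if_neg] at hco
  · exact mem_support_iff.1 hs hco
  · intro h0
    rw [← h0, Finsupp.mapDomain_zero] at hπ
    refine hs0 (Finsupp.mapDomain_injective hρ ?_)
    rw [← hπ, Finsupp.mapDomain_zero]

/-- The determinant of `f` at generic `n × n` matrices has no nonconstant factor in the
`G`-variables. -/
def NoXFactor (f : FreeAlgebra k (G ⊕ H)) (n : ℕ) : Prop :=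
  ∀ q : MvPolynomial (G × Fin n × Fin n) k, IsXFactor f q → ∃ d, q = C d

lemma exists_eq_C_of_rename {σ τ : Type*} {φ : σ → τ} (hφ : Function.Injective φ)
    {q : MvPolynomial σ k} (h : ∃ d, rename φ q = C d) : ∃ d, q = C d := by
  obtain ⟨d, hd⟩ := h
  exact ⟨d, rename_injective φ hφ (by rw [hd, rename_C])⟩

lemma prime_rename {σ τ : Type*} {φ : σ → τ} (hφ : Function.Injective φ) {q : MvPolynomial σ k}
    (hq : Prime q) : Prime (rename φ q) := by
  have h : rename φ q = rename (Subtype.val : Set.range φ → τ)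
      (renameEquiv k (Equiv.ofInjective φ hφ) q) := by
    rw [renameEquiv_apply, rename_rename]
    rfl
  rw [h, prime_rename_iff, MulEquiv.prime_iff]
  exact hq

lemma injective_inl {n : ℕ} :
    Function.Injective (fun v : G × Fin n × Fin n => ((Sum.inl v.1 : G ⊕ H), v.2)) := by
  rintro ⟨j, a⟩ ⟨j', a'⟩ h
  simpa using h

lemma noXFactor_algebraMap {c : k} (hc : c ≠ 0) (n : ℕ) :
    NoXFactor (algebraMap k (FreeAlgebra k (G ⊕ H)) c) n := by
  intro q hq
  rw [IsXFactor, AlgHom.commutes] at hq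
  have h1 := isUnit_of_dvd_unit hq
    ((Matrix.isUnit_iff_isUnit_det _).1 (hc.isUnit.map (algebraMap k _)))
  obtain ⟨d, -, hd⟩ := isUnit_iff_eq_C_of_isReduced.1 h1
  exact exists_eq_C_of_rename injective_inl ⟨d, hd⟩

lemma NoXFactor.mul {f g : FreeAlgebra k (G ⊕ H)} {n : ℕ} (hf : NoXFactor f n)
    (hg : NoXFactor g n) : NoXFactor (f * g) n := by
  intro q hq
  by_contra! h
  have hq0 : q ≠ 0 := fun h0 => h 0 (by simp [h0])
  have hqu : ¬ IsUnit q := fun hu => by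
    obtain ⟨d, -, hd⟩ := isUnit_iff_eq_C_of_isReduced.1 hu
    exact h d hd
  obtain ⟨r, hr, hrq⟩ := WfDvdMonoid.exists_irreducible_factor hqu hq0
  have hrp := prime_rename (injective_inl (G := G) (H := H)) hr.prime
  have hdvd := (map_dvd (rename _) hrq).trans hq
  rw [map_mul, det_mul] at hdvd
  obtain ⟨d, rfl⟩ : ∃ d, r = C d := (hrp.dvd_or_dvd hdvd).elim (hf r) (hg r)
  refine hr.not_isUnit (IsUnit.map C (IsUnit.mk0 d ?_))
  rintro rfl
  exact hr.ne_zero (by simp)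

lemma exists_killCompl_eq_C [IsAlgClosed k] [Fintype G] [Fintype H] {m : Type*} [Fintype m]
    [DecidableEq m] {l : ℕ} [DecidableEq (BWord (G ⊕ H) l)] {f : FreeAlgebra k (G ⊕ H)}
    (hf : constTerm f = 1) (a : G ⊕ H → G ⊕ H → BWord (G ⊕ H) l → k)
    (ha : ∀ j z u, (∀ y ∈ z :: u.1, y ∈ Set.range (Sum.inl : G → G ⊕ H)) → a j z u = 0)
    (ha' : ∀ j, ∀ e ∈ stateSpace f,
      stateOp f j e = ∑ z, ∑ u, a j z u • opWord (stateOp f) (z :: u.1) e)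
    {q : MvPolynomial (G × (m × BWord (G ⊕ H) l) × (m × BWord (G ⊕ H) l)) k}
    (hq : IsXFactor f q) (i : BWord (G ⊕ H) l) :
    ∃ c, killCompl (injective_block i) q = C c := by
  let e : m × BWord (G ⊕ H) l ≃ m × BWord (G ⊕ H) l :=
    (Equiv.refl m).prodCongr (Equiv.swap i BWord.nil)
  have h := exists_killCompl_nil_eq_C hf a ha ha' (hq.reindex e)
  convert h using 3
  conv_lhs => rw [show killCompl (injective_block i) q = evalAt (genMat k G m)
    (killCompl (injective_block i) q) from (aeval_X_left_apply _).symm]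
  conv_rhs => rw [← aeval_X_left_apply (killCompl (injective_block BWord.nil) _)]
  change _ = evalAt (genMat k G m) _
  rw [evalAt_killCompl, evalAt_killCompl]
  simp only [evalAt, aeval_rename]
  congr 2
  funext v
  simp [cornerMat, e, Equiv.swap_apply_eq_iff]

open Filter in
lemma eventually_noXFactor_of_irreducible [IsAlgClosed k] [Fintype G] [Fintype H]
    {f : FreeAlgebra k (G ⊕ H)} (hf : constTerm f = 1) (hconst : ∀ c, f ≠ algebraMap k _ c)
    (hirr : ∀ a b, f = a * b → (∃ c, a = algebraMap k _ c) ∨ ∃ c, b = algebraMap k _ c)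
    (hS : f ∉ Algebra.adjoin k (FreeAlgebra.ι k '' Set.range Sum.inl)) :
    ∀ᶠ l in atTop, ∀ᶠ s in atTop,
      NoXFactor f (Fintype.card (BWord (G ⊕ H) l) ^ (s + 1)) := by
  classical
  have : Infinite k := IsAlgClosed.instInfinite
  obtain ⟨l₀, hl₀⟩ := exists_coeff_of_irreducible hf hconst hirr _ hS
  filter_upwards [eventually_ge_atTop l₀] with l hl
  obtain ⟨a, ha, ha'⟩ := hl₀ l hl
  set c := Fintype.card (BWord (G ⊕ H) l) with hc
  have e : ∀ s, Fin (c ^ (s + 1)) ≃ Fin (c ^ s) × BWord (G ⊕ H) l := fun s =>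
    Fintype.equivOfCardEq (by simp [pow_succ, hc])
  obtain ⟨δ, hδ⟩ := exists_totalDegree_detX_le f
  have hc0 : 0 < c := Fintype.card_pos_iff.2 ⟨BWord.nil⟩
  have hmul : ∀ s, c * (detX f (Fin (c ^ s))).totalDegree ≤
      (detX f (Fin (c ^ (s + 1)))).totalDegree := by
    intro s
    have h := totalDegree_add_le_of_killCompl_eq_C hf
      (one_dvd (detX f (Fin (c ^ s) × BWord (G ⊕ H) l))) fun i => ⟨1, by simp⟩
    rw [totalDegree_detX_congr f (e s)] at h
    simpa using h
  have hev := eventually_succ_lt_of_le_mul_pow hc0 hmul (δ := δ)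
    (fun s => by simpa using hδ (c ^ s))
  filter_upwards [hev] with s hs q hq
  have hinj : Function.Injective (fun v : G × Fin (c ^ (s + 1)) × Fin (c ^ (s + 1)) =>
      (v.1, e s v.2.1, e s v.2.2)) := by
    rintro ⟨j, x, y⟩ ⟨j', x', y'⟩ h
    simpa using h
  refine exists_eq_C_of_rename hinj ?_
  have hq' := hq.reindex (e s)
  have hdeg := totalDegree_add_le_of_killCompl_eq_C hf hq'.dvd_detX
    (exists_killCompl_eq_C hf a ha ha' hq')
  rw [totalDegree_detX_congr f (e s), ← hc] at hdeg
  refine exists_eq_C_of_killCompl_rename BWord.nil ?_ fun σ =>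
    exists_killCompl_nil_eq_C hf a ha ha' (hq'.reindex σ)
  rw [Fintype.card_fin]
  omega

/-- `f` has a nonconstant factor in the subalgebra generated by the letters in `G`. -/
def HasXFactor (f : FreeAlgebra k (G ⊕ H)) : Prop :=
  ∃ u v p : FreeAlgebra k (G ⊕ H), (¬ ∃ c : k, p = algebraMap k _ c) ∧
    (∃ p₀ : FreeAlgebra k G, p = FreeAlgebra.lift k (fun j => FreeAlgebra.ι k (Sum.inl j)) p₀) ∧
    f = u * p * v

lemma HasXFactor.mul_right {f : FreeAlgebra k (G ⊕ H)} (h : HasXFactor f)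
    (g : FreeAlgebra k (G ⊕ H)) : HasXFactor (f * g) := by
  obtain ⟨u, v, p, hp, hp₀, rfl⟩ := h
  exact ⟨u, v * g, p, hp, hp₀, by simp only [mul_assoc]⟩

lemma HasXFactor.mul_left {f : FreeAlgebra k (G ⊕ H)} (h : HasXFactor f)
    (g : FreeAlgebra k (G ⊕ H)) : HasXFactor (g * f) := by
  obtain ⟨u, v, p, hp, hp₀, rfl⟩ := h
  exact ⟨g * u, v, p, hp, hp₀, by simp only [mul_assoc]⟩

lemma hasXFactor_of_mem_adjoin {f : FreeAlgebra k (G ⊕ H)} (hconst : ∀ c, f ≠ algebraMap k _ c)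
    (h : f ∈ Algebra.adjoin k (FreeAlgebra.ι k '' Set.range (Sum.inl : G → G ⊕ H))) :
    HasXFactor f := by
  have hle : Algebra.adjoin k (FreeAlgebra.ι k '' Set.range (Sum.inl : G → G ⊕ H)) ≤
      (FreeAlgebra.lift k (fun j : G =>
        FreeAlgebra.ι k (Sum.inl j : G ⊕ H))).range := by
    refine Algebra.adjoin_le ?_
    rintro _ ⟨_, ⟨j, rfl⟩, rfl⟩
    exact ⟨FreeAlgebra.ι k j, by simp⟩
  obtain ⟨p₀, hp₀⟩ := hle h
  exact ⟨1, 1, f, fun ⟨c, hc⟩ => hconst c hc, ⟨p₀, hp₀.symm⟩, by simp⟩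

open Filter in
lemma hasXFactor_or_eventually_noXFactor [IsAlgClosed k] [Fintype G] [Fintype H]
    {f : FreeAlgebra k (G ⊕ H)} (hf : constTerm f = 1) :
    HasXFactor f ∨ ∀ᶠ l in atTop, ∀ᶠ s in atTop,
      NoXFactor f (Fintype.card (BWord (G ⊕ H) l) ^ (s + 1)) := by
  induction hn : len f using Nat.strong_induction_on generalizing f with
  | _ n ih =>
  by_cases hconst : ∀ c, f ≠ algebraMap k _ c
  swap
  · push Not at hconst
    obtain ⟨c, rfl⟩ := hconst
    have hc : c ≠ 0 := by
      rintro rfl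
      simp at hf
    exact Or.inr (Eventually.of_forall fun l => Eventually.of_forall fun s =>
      noXFactor_algebraMap hc _)
  by_cases hirr : ∀ a b, f = a * b → (∃ c, a = algebraMap k _ c) ∨ ∃ c, b = algebraMap k _ c
  · by_cases hS : f ∈ Algebra.adjoin k (FreeAlgebra.ι k '' Set.range Sum.inl)
    · exact Or.inl (hasXFactor_of_mem_adjoin hconst hS)
    · exact Or.inr (eventually_noXFactor_of_irreducible hf hconst hirr hS)
  push Not at hirr
  obtain ⟨a, b, hab, ha, hb⟩ := hirr
  have hε : constTerm a * constTerm b = 1 := by rw [← map_mul, ← hab, hf]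
  set a' := constTerm b • a with ha'
  set b' := constTerm a • b with hb'
  have hab' : f = a' * b' := by
    rw [ha', hb', smul_mul_smul_comm, mul_comm, hε, one_smul, hab]
  have ha1 : constTerm a' = 1 := by rw [ha', map_smul, smul_eq_mul, mul_comm, hε]
  have hb1 : constTerm b' = 1 := by rw [hb', map_smul, smul_eq_mul, hε]
  have hne : ∀ {g : FreeAlgebra k (G ⊕ H)}, constTerm g = 1 → g ≠ 0 := by
    rintro _ h rfl
    simp at h
  have hlen : ∀ {g : FreeAlgebra k (G ⊕ H)} {c : k}, c ≠ 0 →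
      (∀ d, g ≠ algebraMap k _ d) → 2 ≤ len (c • g) := by
    intro g c hc hg
    by_contra! h
    have h1 := eq_algebraMap_of_mem_degLT_one (len_le_iff.1 (Nat.lt_succ_iff.1 h))
    refine hg (c⁻¹ * constTerm (c • g)) ?_
    rw [map_mul, ← h1, ← Algebra.smul_def, inv_smul_smul₀ hc]
  have h2 := len_mul (hne ha1) (hne hb1)
  have h3 : 2 ≤ len a' := hlen (right_ne_zero_of_mul (hε ▸ one_ne_zero)) ha
  have h4 : 2 ≤ len b' := hlen (left_ne_zero_of_mul (hε ▸ one_ne_zero)) hb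
  rw [← hab'] at h2
  rcases ih (len a') (by omega) ha1 rfl with h | h
  · exact Or.inl (hab' ▸ h.mul_right b')
  rcases ih (len b') (by omega) hb1 rfl with h' | h'
  · exact Or.inl (hab' ▸ h'.mul_left a')
  refine Or.inr ?_
  filter_upwards [h, h'] with l hl hl'
  filter_upwards [hl, hl'] with s hs hs'
  rw [hab']
  exact hs.mul hs'

end Factors

end NCFactor

/-- If `f ∈ k⟨x,y⟩` has nonzero constant term and, for all large `n`, `det f(gX⁽ⁿ⁾, gY⁽ⁿ⁾)`
has a nonconstant factor involving only the `x`-variables, then `f` has a nonconstant factor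
lying in `k⟨x⟩`. -/
theorem factor_in_x_of_det_factor_in_xi
    {k : Type*} [Field k] [IsAlgClosed k] [CharZero k] {g h : ℕ}
    (f : FreeAlgebra k (Fin g ⊕ Fin h))
    (h0 : FreeAlgebra.lift k (fun _ : Fin g ⊕ Fin h => (0 : k)) f ≠ 0)
    (hfac : ∃ n₀ : ℕ, ∀ n ≥ n₀,
      ∃ q : MvPolynomial ((Fin g ⊕ Fin h) × Fin n × Fin n) k,
        (∀ c : k, q ≠ MvPolynomial.C c) ∧
        (∃ q₀ : MvPolynomial (Fin g × Fin n × Fin n) k,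
          q = MvPolynomial.rename
            (fun v : Fin g × Fin n × Fin n => ((Sum.inl v.1 : Fin g ⊕ Fin h), v.2)) q₀) ∧
        q ∣ (FreeAlgebra.lift k (genZ k g h n) f).det) :
    ∃ (u v p : FreeAlgebra k (Fin g ⊕ Fin h)),
      (¬∃ c : k, p = algebraMap k (FreeAlgebra k (Fin g ⊕ Fin h)) c) ∧
      (∃ p₀ : FreeAlgebra k (Fin g),
        p = FreeAlgebra.lift k
          (fun j : Fin g => FreeAlgebra.ι k (Sum.inl j : Fin g ⊕ Fin h)) p₀) ∧
      f = u * p * v := by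
  obtain ⟨n₀, hn₀⟩ := hfac
  set ε := NCFactor.constTerm f with hε
  have hε0 : ε ≠ 0 := h0
  have hf' : NCFactor.constTerm (ε⁻¹ • f) = 1 := by
    rw [map_smul, smul_eq_mul, ← hε, inv_mul_cancel₀ hε0]
  have hf : f = algebraMap k _ ε * (ε⁻¹ • f) := by
    rw [← Algebra.smul_def, smul_inv_smul₀ hε0]
  change NCFactor.HasXFactor f
  rw [hf]
  rcases NCFactor.hasXFactor_or_eventually_noXFactor hf' with hx | hx
  · exact hx.mul_left _
  exfalso
  have hg : Nonempty (Fin g) := by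
    by_contra hg
    rw [not_nonempty_iff] at hg
    obtain ⟨q, hq, ⟨q₀, rfl⟩, -⟩ := hn₀ n₀ le_rfl
    refine hq (coeff 0 q₀) ?_
    conv_lhs => rw [eq_C_of_isEmpty q₀, rename_C]
  obtain ⟨l, hl, hl1⟩ := (hx.and (Filter.eventually_ge_atTop 1)).exists
  have hcard : 1 < Fintype.card (NCFactor.BWord (Fin g ⊕ Fin h) l) := by
    refine Fintype.one_lt_card_iff.2 ⟨⟨[], by simp⟩, ⟨[Sum.inl hg.some], by simpa using hl1⟩, ?_⟩
    simp
  obtain ⟨s, hs, hs1⟩ := (hl.and (Filter.eventually_ge_atTop n₀)).exists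
  have hn : n₀ ≤ Fintype.card (NCFactor.BWord (Fin g ⊕ Fin h) l) ^ (s + 1) :=
    hs1.trans ((Nat.le_succ s).trans (Nat.lt_pow_self hcard).le)
  obtain ⟨q, hq, ⟨q₀, rfl⟩, hdvd⟩ := hn₀ _ hn
  have hX : NCFactor.IsXFactor (algebraMap k _ ε * (ε⁻¹ • f)) q₀ := hf ▸ hdvd
  obtain ⟨d, rfl⟩ := (NCFactor.noXFactor_algebraMap hε0 _).mul hs q₀ hX
  exact hq d (rename_C _ _)
end
end
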